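/- arXiv:math/0304143 — 9 statements merged into one kernel-verified Lean document; each statement's English description precedes it below -/
import Mathlib

section
/- Let D ⊆ (0,1) and f : D → (0,1). Suppose there exist disjoint regular languages L₀, L₁ over the alphabet {0,1} such that L₀ ∪ L₁ has the prefix property and, for every p ∈ D, P_p(L₀ ∪ L₁) = 1 and P_p(L₁) = f(p). Then f is the restriction to D of a rational function over ℚ: there exist polynomials g, h ∈ ℚ[X] such that h(x) ≠ 0 and 0 < g(x)/h(x) < 1 for every x ∈ (0,1), and f(p) = g(p)/h(p) for every p ∈ D. -/
/-- Probability of a word `w` under i.i.d. `p`-coin tosses: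
`p ^ (# of true's) * (1-p) ^ (# of false's)`. -/
noncomputable def wordProb (p : ℝ) (w : List Bool) : ℝ :=
  p ^ (w.count true) * (1 - p) ^ (w.count false)

/-- Probability of a language under i.i.d. `p`-coin tosses. -/
noncomputable def langProb (p : ℝ) (L : Set (List Bool)) : ℝ :=
  ∑' w : L, wordProb p (w : List Bool)

/-- A language has the prefix property if no word of it is a proper prefix
of another word of it. -/
def PrefixFree (L : Set (List Bool)) : Prop :=
  ∀ u ∈ L, ∀ v ∈ L, u ≠ v → ¬ u <+: v

theorem wordProb_nil (p : ℝ) : wordProb p [] = 1 := by simp [wordProb]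

theorem wordProb_cons_true (p : ℝ) (w : List Bool) :
    wordProb p (true :: w) = p * wordProb p w := by
  simp [wordProb, pow_succ]; ring

theorem wordProb_cons_false (p : ℝ) (w : List Bool) :
    wordProb p (false :: w) = (1 - p) * wordProb p w := by
  simp [wordProb, pow_succ]; ring

theorem wordProb_pos {p : ℝ} (hp : p ∈ Set.Ioo (0 : ℝ) 1) (w : List Bool) :
    0 < wordProb p w :=
  mul_pos (pow_pos hp.1 _) (pow_pos (sub_pos.2 hp.2) _)

theorem PrefixFree.mono {L L' : Set (List Bool)} (h : PrefixFree L) (hL : L' ⊆ L) :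
    PrefixFree L' :=
  fun u hu v hv => h u (hL hu) v (hL hv)

theorem PrefixFree.eq_singleton_nil {F : Finset (List Bool)}
    (h : PrefixFree (F : Set (List Bool))) (hF : [] ∈ F) : F = {[]} := by
  ext w
  simp only [Finset.mem_singleton]
  refine ⟨fun hw => ?_, fun hw => hw ▸ hF⟩
  by_contra hne
  exact h [] hF w hw (Ne.symm hne) List.nil_prefix

/-- Optional stopping for nonnegative supermartingales: stopping on a finite prefix-free set
does not increase the expectation. -/
theorem sum_wordProb_mul_le {p : ℝ} (hp : p ∈ Set.Ioo (0 : ℝ) 1) (n : ℕ) :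
    ∀ (F : Finset (List Bool)) (g : List Bool → ℝ), (∀ w ∈ F, w.length ≤ n) →
      PrefixFree (F : Set (List Bool)) → (∀ u, 0 ≤ g u) →
      (∀ u, ∀ w ∈ F, u <+: w → u ≠ w →
        p * g (u ++ [true]) + (1 - p) * g (u ++ [false]) ≤ g u) →
      ∑ w ∈ F, wordProb p w * g w ≤ g [] := by
  induction n with
  | zero =>
    intro F g hlen hF hg _
    have hsub : F ⊆ {[]} := fun w hw => by
      simpa using hlen w hw
    calc ∑ w ∈ F, wordProb p w * g w ≤ ∑ w ∈ {[]}, wordProb p w * g w :=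
          Finset.sum_le_sum_of_subset_of_nonneg hsub
            fun w _ _ => mul_nonneg (wordProb_pos hp w).le (hg w)
      _ = g [] := by simp [wordProb_nil]
  | succ n ih =>
    intro F g hlen hF hg hsuper
    by_cases hnil : [] ∈ F
    · rw [hF.eq_singleton_nil hnil]
      simp [wordProb_nil]
    rcases F.eq_empty_or_nonempty with rfl | ⟨w₀, hw₀⟩
    · simpa using hg []
    have hroot := hsuper [] w₀ hw₀ List.nil_prefix (fun h => hnil (h ▸ hw₀))
    have key : ∀ b : Bool, ∑ w ∈ F.preimage (List.cons b) (List.cons_injective.injOn),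
        wordProb p w * g (b :: w) ≤ g [b] := by
      intro b
      refine ih _ (fun w => g (b :: w)) ?_ ?_ (fun u => hg _) ?_
      · intro w hw
        have := hlen _ (Finset.mem_preimage.1 hw)
        simpa using this
      · intro u hu v hv huv hpre
        simp only [Finset.coe_preimage, Set.mem_preimage] at hu hv
        exact hF _ hu _ hv (by simpa using huv) (by simpa using hpre)
      · intro u w hw huw hne
        exact hsuper (b :: u) (b :: w) (Finset.mem_preimage.1 hw) (by simpa using huw)
          (by simpa using hne)
    have hsplit : F = (F.preimage (List.cons true) (List.cons_injective.injOn)).image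
          (List.cons true) ∪
        (F.preimage (List.cons false) (List.cons_injective.injOn)).image (List.cons false) := by
      ext w
      rcases w with _ | ⟨b, w⟩
      · simpa using hnil
      · cases b <;> simp
    have hdis : Disjoint ((F.preimage (List.cons true) (List.cons_injective.injOn)).image
          (List.cons true))
        ((F.preimage (List.cons false) (List.cons_injective.injOn)).image
          (List.cons false)) := by
      rw [Finset.disjoint_left]
      intro w h1 h2
      rcases w with _ | ⟨b, w⟩
      · simp at h1
      · cases b
        · simp at h1
        · simp at h2
    rw [hsplit, Finset.sum_union hdis, Finset.sum_image (List.cons_injective.injOn),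
      Finset.sum_image (List.cons_injective.injOn)]
    simp only [wordProb_cons_true, wordProb_cons_false, mul_assoc, ← Finset.mul_sum]
    refine le_trans (add_le_add (mul_le_mul_of_nonneg_left (key true) hp.1.le)
      (mul_le_mul_of_nonneg_left (key false) (sub_pos.2 hp.2).le)) hroot

theorem sum_wordProb_le_one {p : ℝ} (hp : p ∈ Set.Ioo (0 : ℝ) 1) {F : Finset (List Bool)}
    (hF : PrefixFree (F : Set (List Bool))) : ∑ w ∈ F, wordProb p w ≤ 1 := by
  simpa using sum_wordProb_mul_le hp (F.sup List.length) F (fun _ => 1)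
    (fun w hw => Finset.le_sup hw) hF (fun _ => zero_le_one) (fun _ _ _ _ _ => by linarith)

theorem sum_subtype_wordProb (p : ℝ) {L : Set (List Bool)} (s : Finset L) :
    ∑ w ∈ s, wordProb p w = ∑ w ∈ s.map (Function.Embedding.subtype _), wordProb p w := by
  simp

theorem coe_map_subtype_subset {L : Set (List Bool)} (s : Finset L) :
    ((s.map (Function.Embedding.subtype (· ∈ L)) : Finset (List Bool)) : Set (List Bool)) ⊆ L := by
  intro w hw
  simp at hw
  exact hw.1

theorem langProb_le {p : ℝ} (hp : p ∈ Set.Ioo (0 : ℝ) 1) {L : Set (List Bool)} {c : ℝ}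
    (h : ∀ F : Finset (List Bool), (F : Set (List Bool)) ⊆ L → ∑ w ∈ F, wordProb p w ≤ c) :
    langProb p L ≤ c :=
  Real.tsum_le_of_sum_le (fun _ => (wordProb_pos hp _).le) fun s =>
    (sum_subtype_wordProb p s).trans_le (h _ (coe_map_subtype_subset s))

theorem PrefixFree.summable {p : ℝ} (hp : p ∈ Set.Ioo (0 : ℝ) 1) {L : Set (List Bool)}
    (hL : PrefixFree L) : Summable fun w : L => wordProb p w :=
  summable_of_sum_le (c := 1) (fun _ => (wordProb_pos hp _).le) fun s =>
    (sum_subtype_wordProb p s).trans_le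
      (sum_wordProb_le_one hp (hL.mono (coe_map_subtype_subset s)))

theorem PrefixFree.langProb_union {p : ℝ} (hp : p ∈ Set.Ioo (0 : ℝ) 1)
    {L₀ L₁ : Set (List Bool)} (hL : PrefixFree (L₀ ∪ L₁)) (hdisj : Disjoint L₀ L₁) :
    langProb p (L₀ ∪ L₁) = langProb p L₀ + langProb p L₁ :=
  Summable.tsum_union_disjoint hdisj ((hL.mono Set.subset_union_left).summable hp)
    ((hL.mono Set.subset_union_right).summable hp)

/-- A prefix-free language of full probability is maximal: every word without prefix in it can
be extended to one of its words. -/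
theorem PrefixFree.exists_append_mem {p : ℝ} (hp : p ∈ Set.Ioo (0 : ℝ) 1) {L : Set (List Bool)}
    (hL : PrefixFree L) (h1 : langProb p L = 1) {u : List Bool} (hu : ∀ v, v <+: u → v ∉ L) :
    ∃ v, u ++ v ∈ L := by
  by_contra! hno
  have hle : langProb p L ≤ 1 - wordProb p u := by
    refine langProb_le hp fun F hF => ?_
    have huF : u ∉ F := fun h => hu u List.prefix_rfl (hF h)
    have hins : PrefixFree ((insert u F : Finset (List Bool)) : Set (List Bool)) := by
      intro a ha b hb hab hpre
      simp only [Finset.coe_insert, Set.mem_insert_iff] at ha hb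
      rcases ha with rfl | ha <;> rcases hb with rfl | hb
      · exact hab rfl
      · obtain ⟨t, rfl⟩ := hpre
        exact hno t (hF hb)
      · exact hu a hpre (hF ha)
      · exact hL a (hF ha) b (hF hb) hab hpre
    have := sum_wordProb_le_one hp hins
    rw [Finset.sum_insert huF] at this
    linarith
  linarith [wordProb_pos hp u]

/-- States reached by reading a word none of whose prefixes lies in `L`. -/
def DFA.liveStates {S : Type*} (M : DFA Bool S) (L : Set (List Bool)) : Set S :=
  {s | ∃ u, M.eval u = s ∧ ∀ v, v <+: u → v ∉ L}

/-- `w` is harmonic on `T` for the walk on states driven by `x`-coin tosses. -/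
def DFA.HarmonicOn {S : Type*} (M : DFA Bool S) (x : ℝ) (T : Set S) (w : S → ℝ) : Prop :=
  ∀ s ∈ T, w s = x * w (M.step s true) + (1 - x) * w (M.step s false)

section Harmonic

variable {S : Type*} {M : DFA Bool S} {x : ℝ} {T : Set S} {w : S → ℝ}

theorem DFA.HarmonicOn.const_sub (hw : M.HarmonicOn x T w) (c : ℝ) :
    M.HarmonicOn x T fun s => c - w s := by
  intro s hs
  simp only
  rw [hw s hs]
  ring

theorem DFA.HarmonicOn.step_eq_of_le (hx : x ∈ Set.Ioo (0 : ℝ) 1) (hw : M.HarmonicOn x T w)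
    {m : ℝ} (hm : ∀ s, w s ≤ m) {s : S} (hs : s ∈ T) (hsm : w s = m) (b : Bool) :
    w (M.step s b) = m := by
  have h := hw s hs
  have h1 := hm (M.step s true)
  have h2 := hm (M.step s false)
  have hx0 := hx.1
  have hx1 := hx.2
  refine le_antisymm (hm _) ?_
  cases b
  · nlinarith
  · nlinarith

/-- Maximum principle for a set `T` that can be escaped from each of its points. -/
theorem DFA.HarmonicOn.le_of_boundary_le [Finite S] (hx : x ∈ Set.Ioo (0 : ℝ) 1)
    (hw : M.HarmonicOn x T w) (hexit : ∀ s ∈ T, ∃ v, M.evalFrom s v ∉ T) {c : ℝ}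
    (hc : ∀ s ∉ T, w s ≤ c) (s : S) : w s ≤ c := by
  have : Nonempty S := ⟨s⟩
  obtain ⟨t, ht⟩ := Finite.exists_max w
  by_contra! hs
  have hlt : c < w t := hs.trans_le (ht s)
  have hT : ∀ r, w r = w t → r ∈ T := fun r hr => by
    by_contra hrT
    exact absurd (hc r hrT) (by rw [hr]; exact not_le.2 hlt)
  have hall : ∀ (v : List Bool) (r : S), w r = w t → M.evalFrom r v ∈ T := by
    intro v
    induction v with
    | nil => exact fun r hr => hT r hr
    | cons b v ih => exact fun r hr => ih _ (hw.step_eq_of_le hx ht (hT r hr) hr b)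
  obtain ⟨v, hv⟩ := hexit t (hT t rfl)
  exact hv (hall v t rfl)

theorem DFA.HarmonicOn.eval_eq_of_le {L : Set (List Bool)} (hx : x ∈ Set.Ioo (0 : ℝ) 1)
    (hw : M.HarmonicOn x (M.liveStates L) w) {m : ℝ} (hm : ∀ s, w s ≤ m) (h0 : w M.start = m)
    (v : List Bool) (hv : ∀ u, u <+: v → u ≠ v → u ∉ L) : w (M.eval v) = m := by
  induction v using List.reverseRecOn with
  | nil => simpa using h0
  | append_singleton v b ih =>
    have hlive : ∀ u, u <+: v → u ∉ L := fun u hu =>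
      hv u (hu.trans (List.prefix_append _ _)) fun h => by
        have := hu.length_le
        simp [h] at this
    rw [DFA.eval_append_singleton]
    exact hw.step_eq_of_le hx hm ⟨v, rfl, hlive⟩ (ih fun u hu _ => hlive u hu) b

theorem PrefixFree.forall_prefix_notMem {L : Set (List Bool)} (hL : PrefixFree L)
    {v : List Bool} (hv : v ∈ L) (u : List Bool) (hu : u <+: v) (hne : u ≠ v) : u ∉ L :=
  fun huL => hL u huL v hv hne hu

theorem DFA.HarmonicOn.langProb_le {L L' : Set (List Bool)} (hx : x ∈ Set.Ioo (0 : ℝ) 1)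
    (hL : PrefixFree L) (hL' : L' ⊆ L) (hw : M.HarmonicOn x (M.liveStates L) w)
    (h0 : ∀ s, 0 ≤ w s) (h1 : ∀ v ∈ L', w (M.eval v) = 1) :
    langProb x L' ≤ w M.start := by
  refine _root_.langProb_le hx fun F hF => ?_
  have h := sum_wordProb_mul_le hx (F.sup List.length) F (fun u => w (M.eval u))
    (fun w hw => Finset.le_sup hw) (hL.mono (hF.trans hL')) (fun u => h0 _) ?_
  · calc ∑ v ∈ F, wordProb x v = ∑ v ∈ F, wordProb x v * w (M.eval v) :=
        Finset.sum_congr rfl fun v hv => by rw [h1 v (hF hv), mul_one]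
      _ ≤ _ := h
  · intro u v hv huv hne
    simp only [DFA.eval_append_singleton]
    refine (hw _ ⟨u, rfl, fun t ht htL => ?_⟩).ge
    refine hL.forall_prefix_notMem (hL' (hF hv)) t (ht.trans huv) (fun htv => ?_) htL
    exact hne (huv.eq_of_length_le (htv ▸ ht.length_le))

end Harmonic

section Dirichlet

open Polynomial Matrix

variable {S : Type*} [Fintype S] [DecidableEq S]

open Classical in
/-- The matrix of the Dirichlet problem on `T`, with the coin bias as an indeterminate. -/
noncomputable def DFA.dirichletMatrix (M : DFA Bool S) (T : Set S) : Matrix S S ℚ[X] :=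
  fun s t => (if s = t then 1 else 0) - if s ∈ T then
    (if M.step s true = t then X else 0) + (if M.step s false = t then 1 - X else 0) else 0

theorem DFA.dirichletMatrix_mulVec (M : DFA Bool S) (T : Set S) (x : ℝ) (v : S → ℝ) (s : S) :
    ((M.dirichletMatrix T).map (aeval x) *ᵥ v) s = v s - open Classical in
      if s ∈ T then x * v (M.step s true) + (1 - x) * v (M.step s false) else 0 := by
  have hentry : ∀ t, (M.dirichletMatrix T).map (aeval x) s t * v t =
      (if s = t then v t else 0) - open Classical in if s ∈ T then
        (if M.step s true = t then x * v t else 0) +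
          (if M.step s false = t then (1 - x) * v t else 0) else 0 := by
    intro t
    simp only [Matrix.map_apply, DFA.dirichletMatrix]
    split_ifs <;> simp <;> ring
  simp only [Matrix.mulVec, dotProduct, hentry, Finset.sum_sub_distrib]
  by_cases hs : s ∈ T <;> simp [hs, Finset.sum_add_distrib]

theorem DFA.det_dirichletMatrix_ne_zero (M : DFA Bool S) {T : Set S}
    (hexit : ∀ s ∈ T, ∃ v, M.evalFrom s v ∉ T) {x : ℝ} (hx : x ∈ Set.Ioo (0 : ℝ) 1) :
    aeval x (M.dirichletMatrix T).det ≠ 0 := by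
  rw [AlgHom.map_det]
  intro hdet
  obtain ⟨v, hv0, hv⟩ := Matrix.exists_mulVec_eq_zero_iff.2 hdet
  have hv' : ∀ s, _ := fun s => (M.dirichletMatrix_mulVec T x v s).symm.trans (congrFun hv s)
  have hharm : M.HarmonicOn x T v := fun s hs => by
    have := hv' s
    simp only [hs, if_true, Pi.zero_apply] at this
    linarith
  have hbd : ∀ s ∉ T, v s = 0 := fun s hs => by
    have := hv' s
    simpa [hs] using this
  refine hv0 (funext fun s => le_antisymm ?_ ?_)
  · exact hharm.le_of_boundary_le hx hexit (fun s hs => (hbd s hs).le) s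
  · have := (hharm.const_sub 0).le_of_boundary_le hx hexit (c := 0)
      (fun s hs => by simp [hbd s hs]) s
    simpa using this

/-- The solution of the Dirichlet problem with rational boundary values is a rational function
of the bias. -/
theorem DFA.exists_rational_harmonicOn (M : DFA Bool S) {T : Set S}
    (hexit : ∀ s ∈ T, ∃ v, M.evalFrom s v ∉ T) (r : S → ℚ) :
    ∃ (g : S → ℚ[X]) (h : ℚ[X]), ∀ x ∈ Set.Ioo (0 : ℝ) 1, aeval x h ≠ 0 ∧
      M.HarmonicOn x T (fun s => aeval x (g s) / aeval x h) ∧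
      ∀ s ∉ T, aeval x (g s) / aeval x h = (r s : ℝ) := by
  classical
  let K := M.dirichletMatrix T
  let b : S → ℚ[X] := fun s => if s ∈ T then 0 else C (r s)
  have hb : ∀ s ∈ T, b s = 0 := fun s hs => if_pos hs
  have hb' : ∀ s ∉ T, b s = C (r s) := fun s hs => if_neg hs
  refine ⟨K.adjugate *ᵥ b, K.det, fun x hx => ?_⟩
  have hdet : aeval x K.det ≠ 0 := M.det_dirichletMatrix_ne_zero hexit hx
  have hsol : ∀ s, (K.map (aeval x) *ᵥ fun t => aeval x ((K.adjugate *ᵥ b) t)) s =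
      aeval x K.det * aeval x (b s) := by
    intro s
    have h : K *ᵥ (K.adjugate *ᵥ b) = K.det • b := by
      rw [Matrix.mulVec_mulVec, Matrix.mul_adjugate, Matrix.smul_mulVec, Matrix.one_mulVec]
    have h2 := congrArg (aeval x) (congrFun h s)
    simpa [Matrix.mulVec, dotProduct, map_sum] using h2
  refine ⟨hdet, fun s hs => ?_, fun s hs => ?_⟩
  · have h := hsol s
    rw [M.dirichletMatrix_mulVec, if_pos hs, hb s hs, map_zero, mul_zero, sub_eq_zero] at h
    simp only
    rw [h]
    ring
  · have h := hsol s
    rw [M.dirichletMatrix_mulVec, if_neg hs, hb' s hs, sub_zero, aeval_C] at h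
    rw [h, mul_div_cancel_left₀ _ hdet]
    simp

end Dirichlet

/-- Two regular languages are recognized by a common transition structure. -/
theorem Language.IsRegular.exists_common_dfa {L₀ L₁ : Language Bool} (h₀ : L₀.IsRegular)
    (h₁ : L₁.IsRegular) : ∃ (S : Type) (_ : Fintype S) (M : DFA Bool S) (A₀ A₁ : Set S),
      (∀ u, u ∈ L₀ ↔ M.eval u ∈ A₀) ∧ ∀ u, u ∈ L₁ ↔ M.eval u ∈ A₁ := by
  obtain ⟨σ₀, _, M₀, rfl⟩ := h₀
  obtain ⟨σ₁, _, M₁, rfl⟩ := h₁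
  let M : DFA Bool (σ₀ × σ₁) :=
    ⟨fun s b => (M₀.step s.1 b, M₁.step s.2 b), (M₀.start, M₁.start), ∅⟩
  have hM : ∀ u, M.eval u = (M₀.eval u, M₁.eval u) := by
    intro u
    induction u using List.reverseRecOn with
    | nil => rfl
    | append_singleton u b ih => simp only [DFA.eval_append_singleton, ih, M]
  refine ⟨σ₀ × σ₁, inferInstance, M, Prod.fst ⁻¹' M₀.accept, Prod.snd ⁻¹' M₁.accept, ?_, ?_⟩
  · intro u
    simp [hM, DFA.mem_accepts]
  · intro u
    simp [hM, DFA.mem_accepts]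

theorem nonempty_of_langProb_pos {p : ℝ} {L : Set (List Bool)} (h : 0 < langProb p L) :
    L.Nonempty := by
  rw [Set.nonempty_iff_ne_empty]
  rintro rfl
  simp [langProb] at h

theorem stmt_0 (D : Set ℝ) (hD : D ⊆ Set.Ioo (0:ℝ) 1) (f : ℝ → ℝ)
    (hf : ∀ p ∈ D, f p ∈ Set.Ioo (0:ℝ) 1)
    (L₀ L₁ : Set (List Bool))
    (hreg₀ : Language.IsRegular (L₀ : Language Bool))
    (hreg₁ : Language.IsRegular (L₁ : Language Bool))
    (hdisj : Disjoint L₀ L₁)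
    (hpre : PrefixFree (L₀ ∪ L₁))
    (htotal : ∀ p ∈ D, langProb p (L₀ ∪ L₁) = 1)
    (hsim : ∀ p ∈ D, langProb p L₁ = f p) :
    ∃ g h : Polynomial ℚ,
      (∀ x ∈ Set.Ioo (0:ℝ) 1, Polynomial.aeval x h ≠ 0 ∧
        0 < Polynomial.aeval x g / Polynomial.aeval x h ∧
        Polynomial.aeval x g / Polynomial.aeval x h < 1) ∧
      (∀ p ∈ D, f p = Polynomial.aeval p g / Polynomial.aeval p h) := by
  classical
  rcases D.eq_empty_or_nonempty with rfl | ⟨p₀, hp₀⟩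
  · exact ⟨1, Polynomial.C 2, fun x _ => by rw [Polynomial.aeval_C]; norm_num, by simp⟩
  obtain ⟨S, _, M, A₀, A₁, hA₀, hA₁⟩ := hreg₀.exists_common_dfa hreg₁
  have hL₀ : ∀ u, u ∈ L₀ ↔ M.eval u ∈ A₀ := hA₀
  have hL₁ : ∀ u, u ∈ L₁ ↔ M.eval u ∈ A₁ := hA₁
  set L := L₀ ∪ L₁ with hL
  have hmem : ∀ u, u ∈ L ↔ M.eval u ∈ A₀ ∪ A₁ := fun u => by simp [hL, hL₀, hL₁]
  have hsum : ∀ p ∈ D, langProb p L₀ = 1 - f p := fun p hp => by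
    have := hpre.langProb_union (hD hp) hdisj
    rw [htotal p hp, hsim p hp] at this
    linarith
  obtain ⟨v₀, hv₀⟩ : L₀.Nonempty :=
    nonempty_of_langProb_pos (p := p₀) (by linarith [hsum p₀ hp₀, (hf p₀ hp₀).2])
  obtain ⟨v₁, hv₁⟩ : L₁.Nonempty :=
    nonempty_of_langProb_pos (p := p₀) (by linarith [hsim p₀ hp₀, (hf p₀ hp₀).1])
  have hnotlive : ∀ u ∈ L, M.eval u ∉ M.liveStates L := by
    rintro u hu ⟨u', hu', hpref⟩
    exact hpref u' List.prefix_rfl ((hmem u').2 (hu' ▸ (hmem u).1 hu))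
  have hexit : ∀ s ∈ M.liveStates L, ∃ v, M.evalFrom s v ∉ M.liveStates L := by
    rintro s ⟨u, rfl, hu⟩
    obtain ⟨v, hv⟩ := hpre.exists_append_mem (hD hp₀) (htotal p₀ hp₀) hu
    refine ⟨v, ?_⟩
    have := hnotlive _ hv
    rwa [DFA.eval, DFA.evalFrom_of_append] at this
  obtain ⟨g, h, hgh⟩ := M.exists_rational_harmonicOn hexit fun s => if s ∈ A₁ then 1 else 0
  have hle : ∀ x ∈ Set.Ioo (0 : ℝ) 1, ∀ s,
      Polynomial.aeval x (g s) / Polynomial.aeval x h ≤ 1 := fun x hx =>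
    (hgh x hx).2.1.le_of_boundary_le hx hexit fun s hs => by
      rw [(hgh x hx).2.2 s hs]
      split_ifs <;> simp
  have hge : ∀ x ∈ Set.Ioo (0 : ℝ) 1, ∀ s,
      0 ≤ Polynomial.aeval x (g s) / Polynomial.aeval x h := fun x hx s => by
    have := ((hgh x hx).2.1.const_sub 0).le_of_boundary_le hx hexit (c := 0) (fun s hs => by
      rw [(hgh x hx).2.2 s hs]
      split_ifs <;> simp) s
    linarith
  have hval₁ : ∀ x ∈ Set.Ioo (0 : ℝ) 1, ∀ v ∈ L₁,
      Polynomial.aeval x (g (M.eval v)) / Polynomial.aeval x h = 1 := fun x hx v hv => by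
    rw [(hgh x hx).2.2 _ (hnotlive v (Or.inr hv)), if_pos ((hL₁ v).1 hv)]
    simp
  have hval₀ : ∀ x ∈ Set.Ioo (0 : ℝ) 1, ∀ v ∈ L₀,
      Polynomial.aeval x (g (M.eval v)) / Polynomial.aeval x h = 0 := fun x hx v hv => by
    rw [(hgh x hx).2.2 _ (hnotlive v (Or.inl hv)),
      if_neg fun hA => Set.disjoint_left.1 hdisj hv ((hL₁ v).2 hA)]
    simp
  refine ⟨g M.start, h, fun x hx => ⟨(hgh x hx).1, ?_, ?_⟩, fun p hp => ?_⟩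
  · refine lt_of_le_of_ne (hge x hx _) fun h0 => ?_
    have := ((hgh x hx).2.1.const_sub 0).eval_eq_of_le hx (m := 0)
      (fun s => by linarith [hge x hx s]) (by simp [← h0]) v₁
      (hpre.forall_prefix_notMem (Or.inr hv₁))
    linarith [hval₁ x hx v₁ hv₁]
  · refine lt_of_le_of_ne (hle x hx _) fun h1 => ?_
    have := (hgh x hx).2.1.eval_eq_of_le hx (hle x hx) h1 v₀
      (hpre.forall_prefix_notMem (Or.inl hv₀))
    linarith [hval₀ x hx v₀ hv₀]
  · have hp' := hD hp
    have h₁ := (hgh p hp').2.1.langProb_le hp' hpre Set.subset_union_right (hge p hp')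
      (hval₁ p hp')
    have h₀ := ((hgh p hp').2.1.const_sub 1).langProb_le hp' hpre Set.subset_union_left
      (fun s => by linarith [hle p hp' s]) (fun v hv => by simp [hval₀ p hp' v hv])
    rw [hsim p hp] at h₁
    rw [hsum p hp] at h₀
    linarith
end

section
/- Let g, h ∈ ℚ[X] be polynomials such that h(x) ≠ 0 and 0 < g(x)/h(x) < 1 for every x ∈ (0,1). Then there exist k ≥ 1 and disjoint sets A₀, A₁ ⊆ {0,1}^k with A₀ ∪ A₁ nonempty, such that for every p ∈ (0,1), P_p(A₀ ∪ A₁) > 0 and g(p)/h(p) = P_p(A₁) / P_p(A₀ ∪ A₁). (Hence every rational function over ℚ mapping (0,1) into (0,1) can be block simulated.) -/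
/-- Probability of a finite set of words under i.i.d. `p`-coin tosses. -/
noncomputable def finsetProb (p : ℝ) (A : Finset (List Bool)) : ℝ :=
  ∑ w ∈ A, wordProb p w

open Polynomial in
/-- Polynomials with nonnegative coefficients are closed under multiplication. -/
lemma coeff_mul_nonneg_of_coeff_nonneg {R : Type*} [CommRing R] [LinearOrder R]
    [IsStrictOrderedRing R] {P Q : R[X]} (hP : ∀ k, 0 ≤ P.coeff k) (hQ : ∀ k, 0 ≤ Q.coeff k)
    (k : ℕ) : 0 ≤ (P * Q).coeff k := by
  rw [coeff_mul]
  exact Finset.sum_nonneg fun x _ => mul_nonneg (hP _) (hQ _)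

open Polynomial in
lemma coeff_one_add_X_pow_nonneg {R : Type*} [CommRing R] [LinearOrder R]
    [IsStrictOrderedRing R] (N k : ℕ) : 0 ≤ ((1 + X : R[X]) ^ N).coeff k := by
  rw [coeff_one_add_X_pow]
  positivity

lemma cast_choose_mul_add_one (N k : ℕ) :
    (N.choose k : ℝ) * (N + 1) = (N + 1).choose k * (N + 1 - k) := by
  have h := Nat.choose_mul_succ_eq N k
  rcases le_or_gt k (N + 1) with hk | hk
  · have h' := congrArg (Nat.cast (R := ℝ)) h
    push_cast [Nat.cast_sub hk] at h'
    exact h'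
  · rw [Nat.choose_eq_zero_of_lt hk, Nat.choose_eq_zero_of_lt (by omega)]
    simp

lemma cast_choose_succ_mul (N k : ℕ) :
    (N.choose k : ℝ) * (N + 1) = (N + 1).choose (k + 1) * (k + 1) := by
  have h := congrArg (Nat.cast (R := ℝ)) (Nat.add_one_mul_choose_eq N k)
  push_cast at h
  linarith

lemma quadratic_form_lower_bound {a b x y M : ℝ} (hx : 0 ≤ x) (hy : 0 ≤ y) (hxy : x + y = M)
    (hab : a ^ 2 < b) (hM : 2 * (1 + b) ^ 2 ≤ (b - a ^ 2) * M) :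
    0 ≤ x * (x - 1) - 2 * a * (x * y) + b * (y * (y - 1)) := by
  have hb : 0 < 1 + b := by nlinarith [sq_nonneg a]
  have hb0 : 0 ≤ b := by nlinarith [sq_nonneg a]
  have h1 : (b - a ^ 2) * (x ^ 2 + y ^ 2) ≤ (1 + b) * (x ^ 2 - 2 * a * x * y + b * y ^ 2) := by
    have ha : 0 < 1 + a ^ 2 := by positivity
    have key : 0 ≤ (1 + a ^ 2) * ((1 + b) * (x ^ 2 - 2 * a * x * y + b * y ^ 2)
        - (b - a ^ 2) * (x ^ 2 + y ^ 2)) := by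
      have : (1 + a ^ 2) * ((1 + b) * (x ^ 2 - 2 * a * x * y + b * y ^ 2)
        - (b - a ^ 2) * (x ^ 2 + y ^ 2)) =
        ((1 + a ^ 2) * x - a * (1 + b) * y) ^ 2 + ((b - a ^ 2) * y) ^ 2 := by ring
      rw [this]; positivity
    nlinarith [nonneg_of_mul_nonneg_right key ha]
  have h2 : (b - a ^ 2) * M ^ 2 ≤ 2 * ((b - a ^ 2) * (x ^ 2 + y ^ 2)) := by
    subst hxy
    nlinarith [mul_nonneg (sub_nonneg.2 hab.le) (sq_nonneg (x - y))]
  have hM0 : 0 ≤ M := by linarith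
  have h3 : 2 * (1 + b) ^ 2 * M ≤ (b - a ^ 2) * M ^ 2 := by
    nlinarith [mul_le_mul_of_nonneg_right hM hM0]
  have h4 : x + b * y ≤ (1 + b) * M := by subst hxy; nlinarith [mul_nonneg hb0 hx]
  have h5 : (1 + b) * (x + b * y) ≤ (1 + b) * (x ^ 2 - 2 * a * x * y + b * y ^ 2) := by
    nlinarith [mul_le_mul_of_nonneg_left h4 hb.le]
  have h6 := le_of_mul_le_mul_left h5 hb
  nlinarith

open Polynomial in
lemma coeff_one_add_X_pow_mul_quadratic (N k : ℕ) (a b : ℝ) :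
    ((1 + X) ^ N * (X ^ 2 - C (2 * a) * X + C b)).coeff k * ((N + 1) * (N + 2)) =
      (N + 2).choose k *
        (k * (k - 1) - 2 * a * (k * ((N : ℝ) + 2 - k)) +
          b * (((N : ℝ) + 2 - k) * ((N : ℝ) + 2 - k - 1))) := by
  have e : ((1 + X) ^ N * (X ^ 2 - C (2 * a) * X + C b) : ℝ[X]) =
      (1 + X) ^ N * X ^ 2 - C (2 * a) * ((1 + X) ^ N * X) + C b * (1 + X) ^ N := by ring
  rw [e, coeff_add, coeff_sub, coeff_C_mul, coeff_C_mul, coeff_one_add_X_pow]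
  have h00 := cast_choose_mul_add_one N k
  have h01 := cast_choose_mul_add_one (N + 1) k
  push_cast at h01
  have E0 : (N.choose k : ℝ) * ((N + 1) * (N + 2)) =
      (N + 2).choose k * ((N + 2 - k) * (N + 2 - k - 1)) := by
    linear_combination ((N : ℝ) + 2) * h00 + ((N : ℝ) + 1 - k) * h01
  rcases k with _ | k
  · rw [coeff_mul_X_zero, coeff_mul_X_pow', if_neg (by norm_num)]
    push_cast at E0 ⊢
    linear_combination b * E0
  rw [coeff_mul_X, coeff_one_add_X_pow]
  have h10 := cast_choose_succ_mul N k
  push_cast at h01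
  have E1 : (N.choose k : ℝ) * ((N + 1) * (N + 2)) =
      (N + 2).choose (k + 1) * ((k + 1) * (N + 2 - (k + 1))) := by
    linear_combination ((N : ℝ) + 2) * h10 + ((k : ℝ) + 1) * h01
  rcases k with _ | k
  · rw [coeff_mul_X_pow', if_neg (by norm_num)]
    push_cast at E0 E1 ⊢
    linear_combination b * E0 - 2 * a * E1
  rw [coeff_mul_X_pow, coeff_one_add_X_pow]
  have h20 := cast_choose_succ_mul N k
  have h21 := cast_choose_succ_mul (N + 1) (k + 1)
  push_cast at h21
  have E2 : (N.choose k : ℝ) * ((N + 1) * (N + 2)) =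
      (N + 2).choose (k + 1 + 1) * ((k + 1 + 1) * (k + 1)) := by
    linear_combination ((N : ℝ) + 2) * h20 + ((k : ℝ) + 1) * h21
  push_cast at E0 E1 ⊢
  linear_combination b * E0 - 2 * a * E1 + E2

open Polynomial in
lemma exists_one_add_X_pow_mul_quadratic_coeff_nonneg {a b : ℝ} (hab : a ^ 2 < b) :
    ∃ N : ℕ, ∀ k, 0 ≤ ((1 + X) ^ N * (X ^ 2 - C (2 * a) * X + C b)).coeff k := by
  obtain ⟨N, hN⟩ := exists_nat_ge (2 * (1 + b) ^ 2 / (b - a ^ 2))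
  refine ⟨N, fun k => ?_⟩
  have hd : 0 < b - a ^ 2 := by linarith
  rw [div_le_iff₀ hd] at hN
  have e := coeff_one_add_X_pow_mul_quadratic N k a b
  refine nonneg_of_mul_nonneg_left (b := ((N : ℝ) + 1) * (N + 2)) ?_ (by positivity)
  rw [e]
  rcases le_or_gt k (N + 2) with hk | hk
  · have hk' : (k : ℝ) ≤ N + 2 := by exact_mod_cast hk
    refine mul_nonneg (by positivity) ?_
    refine quadratic_form_lower_bound (M := N + 2) (by positivity) (by linarith) (by ring) hab ?_
    nlinarith
  · rw [Nat.choose_eq_zero_of_lt hk]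
    simp

open Polynomial in
/-- **Poincaré's theorem**: a real polynomial that is positive on the positive half-line has
nonnegative coefficients after multiplication by a large power of `1 + X`. -/
theorem exists_one_add_X_pow_mul_coeff_nonneg (F : ℝ[X]) (hF : ∀ t, 0 < t → 0 < F.eval t) :
    ∃ N : ℕ, ∀ k, 0 ≤ ((1 + X) ^ N * F).coeff k := by
  induction hn : F.natDegree using Nat.strong_induction_on generalizing F with
  | _ n ih =>
  have step : ∀ P Q : ℝ[X], F = P * Q → 0 < P.natDegree → (∀ t, 0 < t → 0 < P.eval t) →
      (∃ N : ℕ, ∀ k, 0 ≤ ((1 + X) ^ N * P).coeff k) →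
      ∃ N : ℕ, ∀ k, 0 ≤ ((1 + X) ^ N * F).coeff k := by
    rintro P Q rfl hdeg hP ⟨N, hN⟩
    have hQ : ∀ t, 0 < t → 0 < Q.eval t := fun t ht => by
      have := hF t ht
      rw [eval_mul] at this
      exact (pos_iff_pos_of_mul_pos this).1 (hP t ht)
    have hP0 : P ≠ 0 := by rintro rfl; simp at hdeg
    have hQ0 : Q ≠ 0 := by rintro rfl; simpa using hQ 1 one_pos
    rw [natDegree_mul hP0 hQ0] at hn
    obtain ⟨N', hN'⟩ := ih Q.natDegree (by omega) Q hQ rfl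
    refine ⟨N + N', fun k => ?_⟩
    rw [pow_add, mul_mul_mul_comm]
    exact coeff_mul_nonneg_of_coeff_nonneg hN hN' k
  rcases Nat.eq_zero_or_pos n with h0 | hpos
  · rw [h0] at hn
    rw [eq_C_of_natDegree_eq_zero hn] at hF ⊢
    have hc := hF 1 one_pos
    rw [eval_C] at hc
    refine ⟨0, fun k => ?_⟩
    rw [pow_zero, one_mul, coeff_C]
    split_ifs <;> linarith
  obtain ⟨z, hz⟩ := IsAlgClosed.exists_aeval_eq_zero ℂ F
    (natDegree_pos_iff_degree_pos.1 (hn ▸ hpos)).ne'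
  by_cases him : z.im = 0
  · have hzr : z = (z.re : ℂ) := Complex.ext (by simp) (by simp [him])
    have hroot : F.eval z.re = 0 := by
      rw [hzr, show ((z.re : ℂ)) = algebraMap ℝ ℂ z.re from rfl, aeval_algebraMap_apply] at hz
      simpa using hz
    have hre : z.re ≤ 0 := by
      by_contra! hlt
      exact (hF _ hlt).ne' hroot
    obtain ⟨Q, hQ⟩ := dvd_iff_isRoot.2 (show F.IsRoot z.re from hroot)
    refine step _ Q hQ (by simp) (fun t ht => by simp; linarith) ⟨0, fun k => ?_⟩
    rw [pow_zero, one_mul, coeff_sub, coeff_X, coeff_C]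
    split_ifs <;> linarith
  · obtain ⟨Q, hQ⟩ := F.quadratic_dvd_of_aeval_eq_zero_im_ne_zero hz him
    have hlt : z.re ^ 2 < ‖z‖ ^ 2 := by
      rw [← Complex.normSq_eq_norm_sq, Complex.normSq_apply]
      have : 0 < z.im * z.im := mul_self_pos.2 him
      nlinarith
    refine step _ Q hQ ?_ (fun t ht => ?_)
      (exists_one_add_X_pow_mul_quadratic_coeff_nonneg hlt)
    · have : natDegree (X ^ 2 - C (2 * z.re) * X + C (‖z‖ ^ 2)) = 2 := by compute_degree!
      omega
    · simp only [eval_add, eval_sub, eval_mul, eval_pow, eval_X, eval_C]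
      nlinarith [sq_nonneg (t - z.re)]

open Polynomial in
/-- A rational polynomial that is positive on `(0, 1)` is a nonnegative rational combination of the
monomials `x ^ i * (1 - x) ^ (M - i)` for all large `M`. -/
theorem exists_nonneg_bernstein_coeffs (f : ℚ[X]) (hf : ∀ x ∈ Set.Ioo (0 : ℝ) 1, 0 < aeval x f) :
    ∃ M₀ : ℕ, ∀ M ≥ M₀, ∃ c : ℕ → ℚ, (∀ i, 0 ≤ c i) ∧ ∀ x ∈ Set.Ioo (0 : ℝ) 1,
      aeval x f = ∑ i ∈ Finset.range (M + 1), (c i : ℝ) * (x ^ i * (1 - x) ^ (M - i)) := by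
  set n := f.natDegree
  let F : ℚ[X] := ∑ i ∈ Finset.range (n + 1), C (f.coeff i) * (X ^ i * (1 + X) ^ (n - i))
  have hFdeg : F.natDegree ≤ n := by
    refine natDegree_sum_le_of_forall_le _ _ fun i hi => ?_
    rw [Finset.mem_range] at hi
    have h1 : natDegree (1 + X : ℚ[X]) ≤ 1 := by compute_degree
    refine (natDegree_C_mul_le _ _).trans (natDegree_mul_le.trans ?_)
    have h2 := natDegree_pow_le_of_le (n - i) h1
    rw [natDegree_X_pow]
    omega
  have hFeval : ∀ t : ℝ, 0 < t → aeval t F = (1 + t) ^ n * aeval (t / (1 + t)) f := by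
    intro t ht
    have ht' : 1 + t ≠ 0 := by positivity
    rw [aeval_eq_sum_range' (Nat.lt_succ_self _) (t / (1 + t)), Finset.mul_sum]
    simp only [F, map_sum, map_mul, map_pow, map_add, map_one, aeval_X, aeval_C]
    refine Finset.sum_congr rfl fun i hi => ?_
    rw [Finset.mem_range] at hi
    have : (1 + t) ^ n = (1 + t) ^ i * (1 + t) ^ (n - i) := by
      rw [← pow_add]; congr 1; omega
    rw [this, Algebra.smul_def, div_pow]
    field_simp
  obtain ⟨N₀, hN₀⟩ := exists_one_add_X_pow_mul_coeff_nonneg (F.map (algebraMap ℚ ℝ)) fun t ht => by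
    rw [eval_map_algebraMap, hFeval t ht]
    refine mul_pos (by positivity) (hf _ ⟨by positivity, ?_⟩)
    rw [div_lt_one (by positivity)]
    linarith
  refine ⟨n + N₀, fun M hM => ?_⟩
  obtain ⟨d, rfl⟩ := Nat.exists_eq_add_of_le hM
  have hnn : ∀ k, 0 ≤ ((1 + X) ^ N₀ * F).coeff k := fun k => by
    have := hN₀ k
    rw [show ((1 + X) ^ N₀ * F.map (algebraMap ℚ ℝ)) =
      ((1 + X) ^ N₀ * F).map (algebraMap ℚ ℝ) by simp, coeff_map] at this
    simpa using this
  let G : ℚ[X] := (1 + X) ^ d * ((1 + X) ^ N₀ * F)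
  have hGdeg : G.natDegree ≤ n + N₀ + d := by
    have h1 : natDegree (1 + X : ℚ[X]) ≤ 1 := by compute_degree
    have h2 := natDegree_pow_le_of_le d h1
    have h3 := natDegree_pow_le_of_le N₀ h1
    have h4 := natDegree_mul_le (p := (1 + X : ℚ[X]) ^ d) (q := (1 + X) ^ N₀ * F)
    have h5 := natDegree_mul_le (p := (1 + X : ℚ[X]) ^ N₀) (q := F)
    simp only [G]
    omega
  refine ⟨G.coeff, coeff_mul_nonneg_of_coeff_nonneg (coeff_one_add_X_pow_nonneg d) hnn,
    fun x hx => ?_⟩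
  have hx0 : 0 < x := hx.1
  have hx1 : 0 < 1 - x := sub_pos.2 hx.2
  have ht1 : 1 + x / (1 - x) = 1 / (1 - x) := by field_simp; ring
  have htx : x / (1 - x) / (1 + x / (1 - x)) = x := by rw [ht1]; field_simp
  have hG : aeval (x / (1 - x)) G * (1 - x) ^ (n + N₀ + d) = aeval x f := by
    simp only [G, map_mul, map_pow, map_add, map_one, aeval_X]
    rw [hFeval _ (by positivity), htx, ht1]
    rw [pow_add, pow_add, one_div_pow, one_div_pow, one_div_pow]
    field_simp
  rw [← hG, aeval_eq_sum_range' (Nat.lt_succ_of_le hGdeg), Finset.sum_mul]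
  refine Finset.sum_congr rfl fun i hi => ?_
  rw [Finset.mem_range] at hi
  have : (1 - x) ^ (n + N₀ + d) = (1 - x) ^ i * (1 - x) ^ (n + N₀ + d - i) := by
    rw [← pow_add]; congr 1; omega
  rw [this, Algebra.smul_def, div_pow]
  simp only [eq_ratCast]
  field_simp

/-- There are `k.choose j` words of length `k` with `j` letters `true`. -/
lemma exists_finset_words_card_eq_choose (k j : ℕ) : ∃ W : Finset (List Bool),
    W.card = k.choose j ∧ ∀ w ∈ W, w.length = k ∧ w.count true = j := by
  induction k generalizing j with
  | zero =>
    rcases j with _ | j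
    · exact ⟨{[]}, by simp⟩
    · exact ⟨∅, by simp⟩
  | succ k ih =>
    obtain ⟨V, hV, hV'⟩ := ih j
    let f (b : Bool) : List Bool ↪ List Bool := ⟨List.cons b, List.cons_injective⟩
    rcases j with _ | j
    · refine ⟨V.map (f false), by simpa using hV, fun w hw => ?_⟩
      obtain ⟨v, hv, rfl⟩ := Finset.mem_map.1 hw
      have := hV' v hv
      simp [f, this]
    · obtain ⟨U, hU, hU'⟩ := ih j
      have hdis : Disjoint (U.map (f true)) (V.map (f false)) := by
        rw [Finset.disjoint_left]
        intro w h1 h2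
        obtain ⟨u, -, rfl⟩ := Finset.mem_map.1 h1
        obtain ⟨v, -, hv⟩ := Finset.mem_map.1 h2
        simp [f] at hv
      refine ⟨U.map (f true) ∪ V.map (f false), ?_, fun w hw => ?_⟩
      · rw [Finset.card_union_of_disjoint hdis, Finset.card_map, Finset.card_map, hU, hV,
          Nat.choose_succ_succ]
      · rcases Finset.mem_union.1 hw with hw | hw
        · obtain ⟨v, hv, rfl⟩ := Finset.mem_map.1 hw
          have := hU' v hv
          simp [f, this]
        · obtain ⟨v, hv, rfl⟩ := Finset.mem_map.1 hw
          have := hV' v hv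
          simp [f, this]

lemma finsetProb_biUnion {k m M : ℕ} {c : ℕ → ℕ} {A : ℕ → Finset (List Bool)}
    (hA : ∀ i, (A i).card = c i) (hw : ∀ i, ∀ w ∈ A i, w.length = k ∧ w.count true = i + m)
    (p : ℝ) : finsetProb p ((Finset.range M).biUnion A) =
      ∑ i ∈ Finset.range M, (c i : ℝ) * (p ^ (i + m) * (1 - p) ^ (k - (i + m))) := by
  unfold finsetProb
  rw [Finset.sum_biUnion]
  · refine Finset.sum_congr rfl fun i _ => ?_
    rw [← hA i, ← nsmul_eq_mul]
    refine Finset.sum_eq_card_nsmul fun w hwi => ?_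
    obtain ⟨h1, h2⟩ := hw i w hwi
    have h3 := List.count_true_add_count_false w
    rw [wordProb, h2, show w.count false = k - (i + m) by omega]
  · intro i _ j _ hij
    refine Finset.disjoint_left.2 fun w h1 h2 => hij ?_
    have := (hw i w h1).2
    have := (hw j w h2).2
    omega

lemma finsetProb_union_of_disjoint {A B : Finset (List Bool)} (h : Disjoint A B) (p : ℝ) :
    finsetProb p (A ∪ B) = finsetProb p A + finsetProb p B :=
  Finset.sum_union h

/-- Disjoint sets of words realizing prescribed numbers of words of each composition. -/
lemma exists_disjoint_finsets_words (k m M : ℕ) (a b : ℕ → ℕ)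
    (hab : ∀ i < M, a i + b i ≤ k.choose (i + m)) :
    ∃ A B : Finset (List Bool), (∀ w ∈ A ∪ B, w.length = k) ∧ Disjoint A B ∧ ∀ p : ℝ,
      finsetProb p A =
        ∑ i ∈ Finset.range M, (a i : ℝ) * (p ^ (i + m) * (1 - p) ^ (k - (i + m))) ∧
      finsetProb p B =
        ∑ i ∈ Finset.range M, (b i : ℝ) * (p ^ (i + m) * (1 - p) ^ (k - (i + m))) := by
  have key : ∀ i, ∃ A B : Finset (List Bool), Disjoint A B ∧
      A.card = (if i < M then a i else 0) ∧ B.card = (if i < M then b i else 0) ∧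
      (∀ w ∈ A, w.length = k ∧ w.count true = i + m) ∧
      (∀ w ∈ B, w.length = k ∧ w.count true = i + m) := by
    intro i
    split_ifs with hi
    · obtain ⟨W, hW, hW'⟩ := exists_finset_words_card_eq_choose k (i + m)
      have := hab i hi
      obtain ⟨A, hAW, hA⟩ := Finset.exists_subset_card_eq (s := W) (n := a i) (by omega)
      obtain ⟨B, hBW, hB⟩ := Finset.exists_subset_card_eq (s := W \ A) (n := b i) (by
        rw [Finset.card_sdiff_of_subset hAW]; omega)
      exact ⟨A, B, (Finset.disjoint_sdiff).mono_right hBW, hA, hB, fun w h => hW' w (hAW h),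
        fun w h => hW' w (Finset.sdiff_subset (hBW h))⟩
    · exact ⟨∅, ∅, by simp⟩
  choose A B hdis hA hB hwA hwB using key
  refine ⟨(Finset.range M).biUnion A, (Finset.range M).biUnion B, fun w hw => ?_, ?_, fun p => ?_⟩
  · simp only [Finset.mem_union, Finset.mem_biUnion] at hw
    rcases hw with ⟨i, -, hi⟩ | ⟨i, -, hi⟩
    · exact (hwA i w hi).1
    · exact (hwB i w hi).1
  · simp only [Finset.disjoint_biUnion_left, Finset.disjoint_biUnion_right]
    intro j _ i _
    refine Finset.disjoint_left.2 fun w h1 h2 => ?_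
    have e : i = j := by
      have := (hwA i w h1).2
      have := (hwB j w h2).2
      omega
    subst e
    exact Finset.disjoint_left.1 (hdis i) h1 h2
  · rw [finsetProb_biUnion hA hwA, finsetProb_biUnion hB hwB]
    constructor <;>
    · refine Finset.sum_congr rfl fun i hi => ?_
      rw [if_pos (Finset.mem_range.1 hi)]

lemma exists_common_denominator (s : Finset ℕ) (c : ℕ → ℚ) (hc : ∀ i, 0 ≤ c i) :
    ∃ D : ℕ, 0 < D ∧ ∀ E : ℕ, D ∣ E → ∃ a : ℕ → ℕ, ∀ i ∈ s, (a i : ℚ) = E * c i := by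
  refine ⟨∏ i ∈ s, (c i).den, Finset.prod_pos fun i _ => (c i).pos, fun E hE => ?_⟩
  have key : ∀ i, ∃ a : ℕ, i ∈ s → (a : ℚ) = E * c i := by
    intro i
    by_cases hi : i ∈ s
    · obtain ⟨e, rfl⟩ := (Finset.dvd_prod_of_mem (fun i => (c i).den) hi).trans hE
      refine ⟨e * (c i).num.toNat, fun _ => ?_⟩
      have h1 : (((c i).num.toNat : ℤ) : ℚ) = (c i).num := by
        rw [Int.toNat_of_nonneg (Rat.num_nonneg.2 (hc i))]
      have h2 := Rat.mul_den_eq_num (c i)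
      push_cast at h1 ⊢
      rw [h1, ← h2]
      ring
    · exact ⟨0, fun h => absurd h hi⟩
  choose a ha using key
  exact ⟨a, fun i hi => ha i hi⟩

open Polynomial in
/-- Block simulation of `g / (g + f)` for polynomials `g`, `f` that are positive on `(0, 1)`. -/
theorem exists_block_simulation_of_pos (g f : ℚ[X])
    (hg : ∀ x ∈ Set.Ioo (0 : ℝ) 1, 0 < aeval x g) (hf : ∀ x ∈ Set.Ioo (0 : ℝ) 1, 0 < aeval x f) :
    ∃ (k : ℕ) (A₀ A₁ : Finset (List Bool)), 1 ≤ k ∧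
      (∀ w ∈ A₀ ∪ A₁, w.length = k) ∧
      Disjoint A₀ A₁ ∧ (A₀ ∪ A₁).Nonempty ∧
      ∀ p ∈ Set.Ioo (0 : ℝ) 1,
        0 < finsetProb p (A₀ ∪ A₁) ∧
        aeval p g / (aeval p g + aeval p f) = finsetProb p A₁ / finsetProb p (A₀ ∪ A₁) := by
  obtain ⟨M₁, hM₁⟩ := exists_nonneg_bernstein_coeffs g hg
  obtain ⟨M₂, hM₂⟩ := exists_nonneg_bernstein_coeffs f hf
  set M := M₁ + M₂
  obtain ⟨c, hc, hcg⟩ := hM₁ M (by omega)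
  obtain ⟨d, hd, hdf⟩ := hM₂ M (by omega)
  obtain ⟨D₁, hD₁, hc'⟩ := exists_common_denominator (Finset.range (M + 1)) c hc
  obtain ⟨D₂, hD₂, hd'⟩ := exists_common_denominator (Finset.range (M + 1)) d hd
  obtain ⟨a, ha⟩ := hc' (D₁ * D₂) (Dvd.intro _ rfl)
  obtain ⟨b, hb⟩ := hd' (D₁ * D₂) (Dvd.intro_left _ rfl)
  set D := D₁ * D₂
  have hD : 0 < D := Nat.mul_pos hD₁ hD₂
  set m := ∑ i ∈ Finset.range (M + 1), (a i + b i) + 1 with hm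
  have hab : ∀ i < M + 1, b i + a i ≤ (M + 2 * m).choose (i + m) := by
    intro i hi
    have h1 : a i + b i ≤ ∑ i ∈ Finset.range (M + 1), (a i + b i) :=
      Finset.single_le_sum (f := fun i => a i + b i) (fun _ _ => Nat.zero_le _)
        (Finset.mem_range.2 hi)
    have h2 : (i + m + 1).choose (i + m) ≤ (M + 2 * m).choose (i + m) :=
      Nat.choose_le_choose _ (by omega)
    rw [Nat.choose_succ_self_right] at h2
    omega
  obtain ⟨A₀, A₁, hlen, hdis, hprob⟩ := exists_disjoint_finsets_words (M + 2 * m) m (M + 1) b a hab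
  have scale : ∀ (u : ℕ → ℕ) (v : ℕ → ℚ), (∀ i ∈ Finset.range (M + 1), (u i : ℚ) = D * v i) →
      ∀ p : ℝ, ∑ i ∈ Finset.range (M + 1),
        (u i : ℝ) * (p ^ (i + m) * (1 - p) ^ (M + 2 * m - (i + m))) =
      D * (p * (1 - p)) ^ m * ∑ i ∈ Finset.range (M + 1), (v i : ℝ) * (p ^ i * (1 - p) ^ (M - i)) := by
    intro u v huv p
    rw [Finset.mul_sum]
    refine Finset.sum_congr rfl fun i hi => ?_
    have h1 : (u i : ℝ) = D * v i := by exact_mod_cast congrArg (Rat.cast (K := ℝ)) (huv i hi)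
    rw [Finset.mem_range] at hi
    rw [h1, show M + 2 * m - (i + m) = (M - i) + m by omega, mul_pow]
    ring
  have hpos : ∀ p ∈ Set.Ioo (0 : ℝ) 1, 0 < (D : ℝ) * (p * (1 - p)) ^ m := fun p hp => by
    have := hp.1
    have := sub_pos.2 hp.2
    positivity
  have h₀ : ∀ p ∈ Set.Ioo (0 : ℝ) 1, finsetProb p A₀ = D * (p * (1 - p)) ^ m * aeval p f :=
    fun p hp => by rw [(hprob p).1, scale b d hb, hdf p hp]
  have h₁ : ∀ p ∈ Set.Ioo (0 : ℝ) 1, finsetProb p A₁ = D * (p * (1 - p)) ^ m * aeval p g :=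
    fun p hp => by rw [(hprob p).2, scale a c ha, hcg p hp]
  have hunion : ∀ p ∈ Set.Ioo (0 : ℝ) 1, finsetProb p (A₀ ∪ A₁) =
      D * (p * (1 - p)) ^ m * (aeval p g + aeval p f) := fun p hp => by
    rw [finsetProb_union_of_disjoint hdis, h₀ p hp, h₁ p hp]
    ring
  have hupos : ∀ p ∈ Set.Ioo (0 : ℝ) 1, 0 < finsetProb p (A₀ ∪ A₁) := fun p hp => by
    rw [hunion p hp]
    exact mul_pos (hpos p hp) (add_pos (hg p hp) (hf p hp))
  refine ⟨M + 2 * m, A₀, A₁, by omega, hlen, hdis, ?_, fun p hp => ⟨hupos p hp, ?_⟩⟩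
  · rw [Finset.nonempty_iff_ne_empty]
    intro h
    have := hupos (1 / 2) ⟨by norm_num, by norm_num⟩
    rw [h] at this
    simp [finsetProb] at this
  · rw [h₁ p hp, hunion p hp, mul_div_mul_left _ _ (hpos p hp).ne']

open Polynomial in
/-- A polynomial without zeros on `(0, 1)` has constant sign there. -/
lemma aeval_pos_or_neg_of_ne_zero (h : ℚ[X]) (hne : ∀ x ∈ Set.Ioo (0 : ℝ) 1, aeval x h ≠ 0) :
    (∀ x ∈ Set.Ioo (0 : ℝ) 1, 0 < aeval x h) ∨ (∀ x ∈ Set.Ioo (0 : ℝ) 1, 0 < aeval x (-h)) := by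
  by_contra! hcon
  obtain ⟨⟨x, hx, hx0⟩, ⟨y, hy, hy0⟩⟩ := hcon
  rw [map_neg, neg_nonpos] at hy0
  obtain ⟨z, hz, hz0⟩ := isPreconnected_Ioo.intermediate_value hx hy
    (h.continuous_aeval (A := ℝ)).continuousOn ⟨hx0, hy0⟩
  exact hne z hz hz0

theorem stmt_2 (g h : Polynomial ℚ)
    (hgh : ∀ x ∈ Set.Ioo (0:ℝ) 1, Polynomial.aeval x h ≠ 0 ∧
      0 < Polynomial.aeval x g / Polynomial.aeval x h ∧
      Polynomial.aeval x g / Polynomial.aeval x h < 1) :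
    ∃ (k : ℕ) (A₀ A₁ : Finset (List Bool)), 1 ≤ k ∧
      (∀ w ∈ A₀ ∪ A₁, w.length = k) ∧
      Disjoint A₀ A₁ ∧ (A₀ ∪ A₁).Nonempty ∧
      ∀ p ∈ Set.Ioo (0:ℝ) 1,
        0 < finsetProb p (A₀ ∪ A₁) ∧
        Polynomial.aeval p g / Polynomial.aeval p h =
          finsetProb p A₁ / finsetProb p (A₀ ∪ A₁) := by
  wlog hpos : ∀ x ∈ Set.Ioo (0 : ℝ) 1, 0 < Polynomial.aeval x h generalizing g h
  · have hneg := (aeval_pos_or_neg_of_ne_zero h fun x hx => (hgh x hx).1).resolve_left hpos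
    simpa using this (-g) (-h) (by simpa using hgh) hneg
  have hg : ∀ x ∈ Set.Ioo (0 : ℝ) 1, 0 < Polynomial.aeval x g := fun x hx =>
    (div_pos_iff_of_pos_right (hpos x hx)).1 (hgh x hx).2.1
  have hf : ∀ x ∈ Set.Ioo (0 : ℝ) 1, 0 < Polynomial.aeval x (h - g) := fun x hx => by
    rw [map_sub, sub_pos]
    exact (div_lt_one (hpos x hx)).1 (hgh x hx).2.2
  simpa using exists_block_simulation_of_pos g (h - g) hg hf
end

section
/- Let S be a nonempty finite set, δ : S × {0,1} → S a transition function, and R ⊆ S a set of states such that for every s ∈ S there exists a word w ∈ {0,1}* with δ*(s,w) ∈ R. Let 0 < p < 1 and let f : S → ℝ be harmonic, i.e. f(s) = p·f(δ(s,1)) + (1-p)·f(δ(s,0)) for all s ∈ S. Then f attains its maximum and its minimum over S at points of R: there exist r, r' ∈ R such that f(s) ≤ f(r) and f(r') ≤ f(s) for all s ∈ S. -/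
/-- Iterated transition function of an automaton. -/
def deltaStar {S : Type*} (δ : S × Bool → S) : S → List Bool → S
  | s, [] => s
  | s, b :: w => deltaStar δ (δ (s, b)) w

/-- Along every word, a harmonic function stays at its maximum once it attains it. -/
theorem eq_deltaStar_of_forall_le {S : Type*} {δ : S × Bool → S} {p : ℝ} (hp : 0 < p)
    (hp1 : p < 1) {f : S → ℝ}
    (hharm : ∀ s : S, f s = p * f (δ (s, true)) + (1 - p) * f (δ (s, false)))
    (w : List Bool) (m : S) (hm : ∀ s, f s ≤ f m) : f (deltaStar δ m w) = f m := by
  induction w generalizing m with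
  | nil => rfl
  | cons b w ih =>
    have step : f (δ (m, b)) = f m := by
      have h := hharm m
      have ht := hm (δ (m, true))
      have hf := hm (δ (m, false))
      cases b
      · nlinarith
      · nlinarith
    rw [deltaStar, ih _ fun s => (hm s).trans_eq step.symm, step]

/-- A harmonic function attains its maximum on any set reachable from every state. -/
theorem exists_mem_forall_le_of_harmonic {S : Type*} [Finite S] [Nonempty S]
    {δ : S × Bool → S} {R : Set S} (hreach : ∀ s : S, ∃ w : List Bool, deltaStar δ s w ∈ R)
    {p : ℝ} (hp : 0 < p) (hp1 : p < 1) {f : S → ℝ}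
    (hharm : ∀ s : S, f s = p * f (δ (s, true)) + (1 - p) * f (δ (s, false))) :
    ∃ r ∈ R, ∀ s : S, f s ≤ f r := by
  obtain ⟨m, hm⟩ := Finite.exists_max f
  obtain ⟨w, hw⟩ := hreach m
  exact ⟨_, hw, fun s => (hm s).trans_eq (eq_deltaStar_of_forall_le hp hp1 hharm w m hm).symm⟩

theorem stmt_4 (S : Type*) [Fintype S] [Nonempty S]
    (δ : S × Bool → S) (R : Set S)
    (hreach : ∀ s : S, ∃ w : List Bool, deltaStar δ s w ∈ R)
    (p : ℝ) (hp : 0 < p) (hp1 : p < 1)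
    (f : S → ℝ)
    (hharm : ∀ s : S, f s = p * f (δ (s, true)) + (1 - p) * f (δ (s, false))) :
    ∃ r ∈ R, ∃ r' ∈ R, ∀ s : S, f s ≤ f r ∧ f r' ≤ f s := by
  obtain ⟨r, hr, hmax⟩ := exists_mem_forall_le_of_harmonic hreach hp hp1 hharm
  obtain ⟨r', hr', hmin⟩ := exists_mem_forall_le_of_harmonic (f := fun s => -f s) hreach hp hp1
    fun s => by linarith [hharm s]
  exact ⟨r, hr, r', hr', fun s => ⟨hmax s, neg_le_neg_iff.mp (hmin s)⟩⟩
end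

section
/- Let S be a finite set, δ : S × {0,1} → S a transition function, and R ⊆ S a set of states such that for every s ∈ S there exists a word w ∈ {0,1}* with δ*(s,w) ∈ R. Let 0 < p < 1 and let f₁, f₂ : S → ℝ both be harmonic, i.e. f_j(s) = p·f_j(δ(s,1)) + (1-p)·f_j(δ(s,0)) for all s ∈ S and j = 1,2. If f₁(r) = f₂(r) for every r ∈ R, then f₁ = f₂ on all of S. -/
/-- A harmonic function is constant along every path starting at a global maximum. -/
theorem harmonic_deltaStar_eq_of_forall_le {S : Type*} {δ : S × Bool → S} {p : ℝ}
    (hp : 0 < p) (hp1 : p < 1) {f : S → ℝ}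
    (hf : ∀ s, f s = p * f (δ (s, true)) + (1 - p) * f (δ (s, false)))
    (w : List Bool) {s : S} (hs : ∀ t, f t ≤ f s) : f (deltaStar δ s w) = f s := by
  induction w generalizing s with
  | nil => rfl
  | cons b w ih =>
    have hb : f (δ (s, b)) = f s := by
      refine le_antisymm (hs _) ?_
      have h := hf s
      have ht := hs (δ (s, true))
      have hff := hs (δ (s, false))
      cases b <;> nlinarith
    exact (ih fun t => hb.symm ▸ hs t).trans hb

/-- Maximum principle: if the boundary `R` is reachable from every state, an inequality
between harmonic functions on `R` holds everywhere. -/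
theorem harmonic_le_of_le_on {S : Type*} [Finite S] {δ : S × Bool → S} {R : Set S}
    (hreach : ∀ s, ∃ w, deltaStar δ s w ∈ R) {p : ℝ} (hp : 0 < p) (hp1 : p < 1) {f g : S → ℝ}
    (hf : ∀ s, f s = p * f (δ (s, true)) + (1 - p) * f (δ (s, false)))
    (hg : ∀ s, g s = p * g (δ (s, true)) + (1 - p) * g (δ (s, false)))
    (hR : ∀ r ∈ R, f r ≤ g r) (s : S) : f s ≤ g s := by
  have : Nonempty S := ⟨s⟩
  obtain ⟨m, hm⟩ := Finite.exists_max (fun t => f t - g t)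
  obtain ⟨w, hw⟩ := hreach m
  have hconst := harmonic_deltaStar_eq_of_forall_le (f := fun t => f t - g t) hp hp1
    (fun t => by linear_combination hf t - hg t) w hm
  have := hR _ hw
  have := hm s
  linarith

theorem stmt_5 (S : Type*) [Fintype S]
    (δ : S × Bool → S) (R : Set S)
    (hreach : ∀ s : S, ∃ w : List Bool, deltaStar δ s w ∈ R)
    (p : ℝ) (hp : 0 < p) (hp1 : p < 1)
    (f₁ f₂ : S → ℝ)
    (hharm₁ : ∀ s : S, f₁ s = p * f₁ (δ (s, true)) + (1 - p) * f₁ (δ (s, false)))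
    (hharm₂ : ∀ s : S, f₂ s = p * f₂ (δ (s, true)) + (1 - p) * f₂ (δ (s, false)))
    (hR : ∀ r ∈ R, f₁ r = f₂ r) :
    ∀ s : S, f₁ s = f₂ s := by
  intro s
  exact le_antisymm
    (harmonic_le_of_le_on hreach hp hp1 hharm₁ hharm₂ (fun r hr => (hR r hr).le) s)
    (harmonic_le_of_le_on hreach hp hp1 hharm₂ hharm₁ (fun r hr => (hR r hr).ge) s)
end

section
/- Let D ⊆ (0,1) and f : D → (0,1). Then f can be block simulated (i.e., there exist k ≥ 1 and disjoint sets A₀, A₁ ⊆ {0,1}^k with A₀ ∪ A₁ nonempty such that for every p ∈ D, P_p(A₀ ∪ A₁) > 0 and f(p) = P_p(A₁)/P_p(A₀ ∪ A₁)) if and only if there exist k ≥ 0 and integers d₀,…,d_k, e₀,…,e_k with 0 ≤ dᵢ ≤ eᵢ for all i and not all eᵢ equal to zero, such that for every p ∈ D, f(p) = (∑_{i=0}^{k} dᵢ pⁱ(1-p)^{k-i}) / (∑_{i=0}^{k} eᵢ pⁱ(1-p)^{k-i}). -/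
theorem List.count_false_eq_length_sub (w : List Bool) :
    w.count false = w.length - w.count true := by
  have := List.count_true_add_count_false w
  omega

theorem finsetProb_pos {p : ℝ} (hp : p ∈ Set.Ioo (0 : ℝ) 1) {A : Finset (List Bool)}
    (hA : A.Nonempty) : 0 < finsetProb p A :=
  Finset.sum_pos (fun w _ => wordProb_pos hp w) hA

/-- Grouping words of a common length by their number of ones. -/
theorem finsetProb_eq_sum_card (p : ℝ) {k : ℕ} {A : Finset (List Bool)}
    (hA : ∀ w ∈ A, w.length = k) :
    finsetProb p A = ∑ i ∈ Finset.range (k + 1),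
      ((A.filter (fun w => w.count true = i)).card : ℝ) * p ^ i * (1 - p) ^ (k - i) := by
  have hmaps : ∀ w ∈ A, w.count true ∈ Finset.range (k + 1) := fun w hw =>
    Finset.mem_range_succ_iff.2 (hA w hw ▸ List.count_le_length)
  rw [finsetProb, ← Finset.sum_fiberwise_of_maps_to hmaps]
  refine Finset.sum_congr rfl fun i _ => ?_
  rw [mul_assoc, ← nsmul_eq_mul]
  refine Finset.sum_eq_card_nsmul fun w hw => ?_
  obtain ⟨hwA, hwi⟩ := Finset.mem_filter.1 hw
  rw [wordProb, List.count_false_eq_length_sub, hA w hwA, hwi]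

/-- For `t < N` and `i ≤ k`, the word whose first `N` letters contain a single one, in position `t`,
and whose last `k` letters are `i` ones followed by zeros. -/
def markedWord (N k : ℕ) (x : (_ : ℕ) × ℕ) : List Bool :=
  List.replicate x.2 false ++ true :: (List.replicate (N - 1 - x.2) false ++
    (List.replicate x.1 true ++ List.replicate (k - x.1) false))

theorem count_true_markedWord (N k : ℕ) (x : (_ : ℕ) × ℕ) :
    (markedWord N k x).count true = x.1 + 1 := by
  simp [markedWord, List.count_replicate]

theorem length_markedWord {N k : ℕ} {x : (_ : ℕ) × ℕ} (hi : x.1 ≤ k) (ht : x.2 < N) :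
    (markedWord N k x).length = N + k := by
  simp only [markedWord, List.length_append, List.length_cons, List.length_replicate]
  omega

theorem idxOf_true_markedWord (N k : ℕ) (x : (_ : ℕ) × ℕ) :
    (markedWord N k x).idxOf true = x.2 := by
  simp [markedWord, List.idxOf_append]

theorem markedWord_injective (N k : ℕ) : Function.Injective (markedWord N k) := by
  rintro ⟨i, t⟩ ⟨j, s⟩ h
  have hcount := congrArg (List.count true) h
  have hidx := congrArg (List.idxOf true) h
  simp only [count_true_markedWord, idxOf_true_markedWord] at hcount hidx
  obtain rfl : i = j := by omega
  rw [hidx]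

theorem wordProb_markedWord (p : ℝ) {N k : ℕ} {x : (_ : ℕ) × ℕ} (hi : x.1 ≤ k) (ht : x.2 < N) :
    wordProb p (markedWord N k x) =
      p ^ x.1 * (1 - p) ^ (k - x.1) * (p * (1 - p) ^ (N - 1)) := by
  rw [wordProb, List.count_false_eq_length_sub, count_true_markedWord, length_markedWord hi ht,
    show N + k - (x.1 + 1) = (k - x.1) + (N - 1) by omega]
  ring

/-- The set consisting of `c i` marked words with `i + 1` ones for every `i ≤ k`. -/
def markedWords (N k : ℕ) (c : ℕ → ℕ) : Finset (List Bool) :=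
  ((Finset.range (k + 1)).sigma fun i => Finset.range (c i)).image (markedWord N k)

theorem length_of_mem_markedWords {N k : ℕ} {c : ℕ → ℕ} (hc : ∀ i ≤ k, c i ≤ N) {w : List Bool}
    (hw : w ∈ markedWords N k c) : w.length = N + k := by
  simp only [markedWords, Finset.mem_image, Finset.mem_sigma, Finset.mem_range] at hw
  obtain ⟨x, ⟨hi, ht⟩, rfl⟩ := hw
  have hi : x.1 ≤ k := Nat.lt_succ_iff.1 hi
  exact length_markedWord hi (ht.trans_le (hc _ hi))

theorem markedWords_mono (N : ℕ) {k : ℕ} {c c' : ℕ → ℕ} (h : ∀ i ≤ k, c i ≤ c' i) :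
    markedWords N k c ⊆ markedWords N k c' := by
  refine Finset.image_subset_image fun x hx => ?_
  simp only [Finset.mem_sigma, Finset.mem_range] at hx ⊢
  exact ⟨hx.1, hx.2.trans_le (h _ (Nat.lt_succ_iff.1 hx.1))⟩

theorem markedWords_nonempty (N : ℕ) {k : ℕ} {c : ℕ → ℕ} (h : ∃ i ≤ k, c i ≠ 0) :
    (markedWords N k c).Nonempty := by
  obtain ⟨i, hi, hc⟩ := h
  refine Finset.Nonempty.image ⟨⟨i, 0⟩, ?_⟩ _
  simp only [Finset.mem_sigma, Finset.mem_range]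
  omega

theorem finsetProb_markedWords (p : ℝ) {N k : ℕ} {c : ℕ → ℕ} (hc : ∀ i ≤ k, c i ≤ N) :
    finsetProb p (markedWords N k c) =
      (∑ i ∈ Finset.range (k + 1), (c i : ℝ) * p ^ i * (1 - p) ^ (k - i)) *
        (p * (1 - p) ^ (N - 1)) := by
  rw [finsetProb, markedWords, Finset.sum_image (markedWord_injective N k).injOn,
    Finset.sum_sigma, Finset.sum_mul]
  refine Finset.sum_congr rfl fun i hi => ?_
  have hi : i ≤ k := Finset.mem_range_succ_iff.1 hi
  rw [Finset.sum_congr rfl fun t ht =>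
    wordProb_markedWord p (x := ⟨i, t⟩) hi ((Finset.mem_range.1 ht).trans_le (hc i hi))]
  simp only [Finset.sum_const, Finset.card_range, nsmul_eq_mul]
  ring

theorem stmt_6 (D : Set ℝ) (hD : D ⊆ Set.Ioo (0:ℝ) 1) (f : ℝ → ℝ)
    (hf : ∀ p ∈ D, f p ∈ Set.Ioo (0:ℝ) 1) :
    (∃ (k : ℕ) (A₀ A₁ : Finset (List Bool)), 1 ≤ k ∧
      (∀ w ∈ A₀ ∪ A₁, w.length = k) ∧
      Disjoint A₀ A₁ ∧ (A₀ ∪ A₁).Nonempty ∧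
      ∀ p ∈ D,
        0 < finsetProb p (A₀ ∪ A₁) ∧
        f p = finsetProb p A₁ / finsetProb p (A₀ ∪ A₁)) ↔
    (∃ (k : ℕ) (d e : ℕ → ℤ),
      (∀ i ≤ k, 0 ≤ d i ∧ d i ≤ e i) ∧
      (∃ i ≤ k, e i ≠ 0) ∧
      ∀ p ∈ D,
        f p = (∑ i ∈ Finset.range (k + 1), (d i : ℝ) * p ^ i * (1 - p) ^ (k - i)) /
              (∑ i ∈ Finset.range (k + 1), (e i : ℝ) * p ^ i * (1 - p) ^ (k - i))) := by
  constructor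
  · rintro ⟨k, A₀, A₁, -, hlen, -, ⟨w, hw⟩, hprob⟩
    refine ⟨k, fun i => (A₁.filter (fun w => w.count true = i)).card,
      fun i => ((A₀ ∪ A₁).filter (fun w => w.count true = i)).card,
      fun i _ => ⟨by positivity, ?_⟩, ⟨w.count true, hlen w hw ▸ List.count_le_length, ?_⟩,
      fun p hp => ?_⟩
    · exact Int.ofNat_le.2 (Finset.card_le_card
        (Finset.filter_subset_filter _ Finset.subset_union_right))
    · exact Int.natCast_ne_zero.2 <| Finset.card_ne_zero_of_mem (Finset.mem_filter.2 ⟨hw, rfl⟩)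
    · rw [(hprob p hp).2, finsetProb_eq_sum_card p hlen,
        finsetProb_eq_sum_card p fun w hw => hlen w (Finset.mem_union_right _ hw)]
      simp only [Int.cast_natCast]
  · rintro ⟨k, d, e, hde, ⟨j, hj, hej⟩, hfp⟩
    set N := ∑ i ∈ Finset.range (k + 1), (e i).toNat
    have heN : ∀ i ≤ k, (e i).toNat ≤ N := fun i hi =>
      Finset.single_le_sum (f := fun i => (e i).toNat) (fun _ _ => Nat.zero_le _)
        (Finset.mem_range_succ_iff.2 hi)
    have hdele : ∀ i ≤ k, (d i).toNat ≤ (e i).toNat := fun i hi => Int.toNat_le_toNat (hde i hi).2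
    have hej' : (e j).toNat ≠ 0 := by
      have := hde j hj
      omega
    have hunion : markedWords N k (fun i => (e i).toNat) \ markedWords N k (fun i => (d i).toNat) ∪
        markedWords N k (fun i => (d i).toNat) = markedWords N k (fun i => (e i).toNat) :=
      Finset.sdiff_union_of_subset (markedWords_mono N hdele)
    refine ⟨N + k, markedWords N k (fun i => (e i).toNat) \ markedWords N k (fun i => (d i).toNat),
      markedWords N k (fun i => (d i).toNat), ?_, ?_, Finset.sdiff_disjoint, ?_, fun p hp => ?_⟩
    · have := heN j hj
      omega
    · rw [hunion]
      exact fun w hw => length_of_mem_markedWords heN hw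
    · rw [hunion]
      exact markedWords_nonempty N ⟨j, hj, hej'⟩
    · have hcast : ∀ c : ℕ → ℤ, (∀ i ≤ k, 0 ≤ c i) →
          ∑ i ∈ Finset.range (k + 1), ((c i).toNat : ℝ) * p ^ i * (1 - p) ^ (k - i) =
            ∑ i ∈ Finset.range (k + 1), (c i : ℝ) * p ^ i * (1 - p) ^ (k - i) := by
        refine fun c hc => Finset.sum_congr rfl fun i hi => ?_
        rw [← Int.cast_natCast, Int.toNat_of_nonneg (hc i (Finset.mem_range_succ_iff.1 hi))]
      have hfactor : p * (1 - p) ^ (N - 1) ≠ 0 :=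
        (mul_pos (hD hp).1 (pow_pos (sub_pos.2 (hD hp).2) _)).ne'
      rw [hunion]
      refine ⟨finsetProb_pos (hD hp) (markedWords_nonempty N ⟨j, hj, hej'⟩), ?_⟩
      rw [finsetProb_markedWords p heN,
        finsetProb_markedWords p fun i hi => (hdele i hi).trans (heN i hi),
        mul_div_mul_right _ _ hfactor, hcast d fun i hi => (hde i hi).1,
        hcast e fun i hi => (hde i hi).1.trans (hde i hi).2]
      exact hfp p hp
end

section
/- Let g, h ∈ ℚ[X] be polynomials such that h(x) ≠ 0 and 0 < g(x)/h(x) < 1 for every x ∈ (0,1). Then there exist k ≥ 0 and integers d₀,…,d_k, e₀,…,e_k with 0 ≤ dᵢ ≤ eᵢ for all i and not all eᵢ equal to zero, such that for every p ∈ (0,1), g(p)/h(p) = (∑_{i=0}^{k} dᵢ pⁱ(1-p)^{k-i}) / (∑_{i=0}^{k} eᵢ pⁱ(1-p)^{k-i}). -/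
open Polynomial in
/-- `P` is a combination of the polynomials `X ^ i * (1 - X) ^ (n - i)`, `i ≤ n`, with nonnegative
rational coefficients. -/
def HasNonnegBernsteinForm (n : ℕ) (P : ℚ[X]) : Prop :=
  ∃ c : ℕ → ℚ, (∀ i, 0 ≤ c i) ∧
    P = ∑ i ∈ Finset.range (n + 1), C (c i) * X ^ i * (1 - X) ^ (n - i)

namespace HasNonnegBernsteinForm

open Polynomial

variable {n m : ℕ} {P Q : ℚ[X]}

theorem add (hP : HasNonnegBernsteinForm n P) (hQ : HasNonnegBernsteinForm n Q) :
    HasNonnegBernsteinForm n (P + Q) := by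
  obtain ⟨c, hc, rfl⟩ := hP
  obtain ⟨d, hd, rfl⟩ := hQ
  refine ⟨fun i => c i + d i, fun i => add_nonneg (hc i) (hd i), ?_⟩
  rw [← Finset.sum_add_distrib]
  refine Finset.sum_congr rfl fun i _ => ?_
  rw [C_add]
  ring

theorem X_mul (hP : HasNonnegBernsteinForm n P) : HasNonnegBernsteinForm (n + 1) (X * P) := by
  obtain ⟨c, hc, rfl⟩ := hP
  refine ⟨fun i => if i = 0 then 0 else c (i - 1), fun i => ?_, ?_⟩
  · dsimp only
    split_ifs
    exacts [le_rfl, hc _]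
  · rw [Finset.sum_range_succ' _ (n + 1), Finset.mul_sum]
    simp only [Nat.add_sub_cancel, Nat.add_sub_add_right, if_true, Nat.succ_ne_zero, if_false,
      map_zero, zero_mul, add_zero]
    refine Finset.sum_congr rfl fun i _ => ?_
    ring

theorem one_sub_X_mul (hP : HasNonnegBernsteinForm n P) :
    HasNonnegBernsteinForm (n + 1) ((1 - X) * P) := by
  obtain ⟨c, hc, rfl⟩ := hP
  refine ⟨fun i => if i = n + 1 then 0 else c i, fun i => ?_, ?_⟩
  · dsimp only
    split_ifs
    exacts [le_rfl, hc _]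
  · rw [Finset.sum_range_succ _ (n + 1), Finset.mul_sum]
    simp only [if_true, map_zero, zero_mul, add_zero]
    refine Finset.sum_congr rfl fun i hi => ?_
    have hi' : i < n + 1 := Finset.mem_range.1 hi
    rw [if_neg hi'.ne, Nat.succ_sub (by omega : i ≤ n), pow_succ]
    ring

theorem mono (hP : HasNonnegBernsteinForm n P) (h : n ≤ m) : HasNonnegBernsteinForm m P := by
  induction m, h using Nat.le_induction with
  | base => exact hP
  | succ m _ ih =>
    have := ih.X_mul.add ih.one_sub_X_mul
    rwa [← add_mul, add_sub_cancel, one_mul] at this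

end HasNonnegBernsteinForm

theorem Nat.cast_choose_succ_div_choose_succ {i j n : ℕ} (hj : j < n) :
    (i.choose (j + 1) : ℝ) / n.choose (j + 1) =
      (i.choose j : ℝ) / n.choose j * (((i : ℝ) - j) / ((n : ℝ) - j)) := by
  have key (a : ℕ) : (a.choose (j + 1) : ℝ) * (j + 1) = a.choose j * ((a : ℝ) - j) := by
    rcases le_or_gt j a with h | h
    · rw [← Nat.cast_sub h]
      exact_mod_cast Nat.choose_succ_right_eq a j
    · simp [Nat.choose_eq_zero_of_lt h, Nat.choose_eq_zero_of_lt (h.trans (Nat.lt_succ_self j))]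
  have h1 : (0 : ℝ) < n.choose (j + 1) := by exact_mod_cast Nat.choose_pos hj
  have h3 : (0 : ℝ) < (n : ℝ) - j := sub_pos.2 (by exact_mod_cast hj)
  have h4 : (0 : ℝ) < (j : ℝ) + 1 := by positivity
  rw [_root_.div_mul_div_comm, ← key, ← key, _root_.mul_div_mul_right _ _ h4.ne']

theorem eventually_abs_choose_div_choose_sub_pow_le (j : ℕ) :
    ∀ ε > (0 : ℝ), ∀ᶠ n : ℕ in Filter.atTop, ∀ i ≤ n,
      |(i.choose j : ℝ) / n.choose j - ((i : ℝ) / n) ^ j| ≤ ε := by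
  induction j with
  | zero => intro ε hε; simp [hε.le]
  | succ j ih =>
    intro ε hε
    filter_upwards [ih (ε / 2) (half_pos hε), Filter.eventually_gt_atTop j,
      Filter.eventually_ge_atTop ⌈(j : ℝ) + j / (ε / 2)⌉₊] with n hn hjn hnε i hi
    have hnε' : (j : ℝ) + j / (ε / 2) ≤ n := Nat.ceil_le.1 hnε
    have hnj : (0 : ℝ) < (n : ℝ) - j := sub_pos.2 (by exact_mod_cast hjn)
    have hn0 : (0 : ℝ) < n := by exact_mod_cast (Nat.zero_le j).trans_lt hjn
    have hin : (i : ℝ) ≤ n := by exact_mod_cast hi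
    rw [Nat.cast_choose_succ_div_choose_succ hjn, pow_succ]
    set r : ℝ := (i.choose j : ℝ) / n.choose j
    set y : ℝ := (i : ℝ) / n with hy
    have hr0 : 0 ≤ r := by positivity
    have hr1 : r ≤ 1 := div_le_one_of_le₀ (by exact_mod_cast Nat.choose_le_choose j hi)
      (by positivity)
    have hy0 : 0 ≤ y := by positivity
    have hy1 : y ≤ 1 := div_le_one_of_le₀ hin hn0.le
    have hs : |((i : ℝ) - j) / ((n : ℝ) - j) - y| ≤ ε / 2 := by
      have e : ((i : ℝ) - j) / ((n : ℝ) - j) - y = -(j / ((n : ℝ) - j) * (1 - y)) := by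
        rw [hy]
        field_simp
        ring
      have hjε : j / ((n : ℝ) - j) ≤ ε / 2 := by
        rw [div_le_iff₀ hnj, mul_comm, ← div_le_iff₀ (half_pos hε)]
        linarith
      have hj0 : 0 ≤ j / ((n : ℝ) - j) := by positivity
      rw [e, abs_neg, abs_of_nonneg (mul_nonneg hj0 (by linarith))]
      nlinarith
    calc |r * (((i : ℝ) - j) / ((n : ℝ) - j)) - y ^ j * y|
        = |r * (((i : ℝ) - j) / ((n : ℝ) - j) - y) + (r - y ^ j) * y| := by congr 1; ring
      _ ≤ r * |((i : ℝ) - j) / ((n : ℝ) - j) - y| + |r - y ^ j| * y := by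
        refine (abs_add_le _ _).trans_eq ?_
        rw [abs_mul, abs_mul, abs_of_nonneg hr0, abs_of_nonneg hy0]
      _ ≤ 1 * (ε / 2) + (ε / 2) * 1 := by
        gcongr
        exact hn i hi
      _ = ε := by ring

namespace Polynomial

theorem choose_mul_X_pow_eq_sum {j n : ℕ} (hj : j ≤ n) :
    (n.choose j : ℚ[X]) * X ^ j = ∑ i ∈ Finset.range (n + 1),
      ((n.choose i * i.choose j : ℕ) : ℚ[X]) * X ^ i * (1 - X) ^ (n - i) := by
  obtain ⟨m, rfl⟩ := Nat.exists_eq_add_of_le hj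
  rw [add_assoc, Finset.sum_range_add, Finset.sum_eq_zero, zero_add]
  · have h1 := add_pow (X : ℚ[X]) (1 - X) m
    rw [add_sub_cancel, one_pow] at h1
    conv_lhs => rw [← mul_one ((_ : ℚ[X]) * X ^ j), h1, Finset.mul_sum]
    refine Finset.sum_congr rfl fun i _ => ?_
    rw [Nat.choose_mul (Nat.le_add_right j i), Nat.add_sub_add_left, Nat.add_sub_cancel_left,
      Nat.add_sub_cancel_left, pow_add, Nat.cast_mul]
    ring
  · intro i hi
    rw [Nat.choose_eq_zero_of_lt (Finset.mem_range.1 hi)]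
    simp

theorem eq_sum_bernstein_form (P : ℚ[X]) {n : ℕ} (hn : P.natDegree ≤ n) :
    P = ∑ i ∈ Finset.range (n + 1),
      C (n.choose i * ∑ j ∈ Finset.range (P.natDegree + 1),
        P.coeff j * ((i.choose j : ℚ) / n.choose j)) * X ^ i * (1 - X) ^ (n - i) := by
  have hX : ∀ j ∈ Finset.range (P.natDegree + 1), C (P.coeff j) * X ^ j =
      ∑ i ∈ Finset.range (n + 1),
        C (n.choose i * (P.coeff j * ((i.choose j : ℚ) / n.choose j))) * X ^ i *
          (1 - X) ^ (n - i) := by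
    intro j hj
    have hjn : j ≤ n := (Nat.lt_succ_iff.1 (Finset.mem_range.1 hj)).trans hn
    have h0 : (n.choose j : ℚ) ≠ 0 := by exact_mod_cast (Nat.choose_pos hjn).ne'
    have h1 : C (P.coeff j) * X ^ j =
        C (P.coeff j / n.choose j) * ((n.choose j : ℚ[X]) * X ^ j) := by
      rw [← mul_assoc, ← C_eq_natCast, ← C_mul, div_mul_cancel₀ _ h0]
    rw [h1, choose_mul_X_pow_eq_sum hjn, Finset.mul_sum]
    refine Finset.sum_congr rfl fun i _ => ?_
    rw [← C_eq_natCast, ← mul_assoc, ← mul_assoc, ← C_mul]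
    congr 3
    push_cast
    ring
  conv_lhs => rw [P.as_sum_range_C_mul_X_pow, Finset.sum_congr rfl hX, Finset.sum_comm]
  refine Finset.sum_congr rfl fun i _ => ?_
  rw [Finset.mul_sum, map_sum, Finset.sum_mul, Finset.sum_mul]

theorem exists_hasNonnegBernsteinForm_of_pos_Icc (P : ℚ[X])
    (hP : ∀ x ∈ Set.Icc (0 : ℝ) 1, 0 < aeval x P) : ∃ n, HasNonnegBernsteinForm n P := by
  obtain ⟨x₀, hx₀, hmin⟩ := isCompact_Icc.exists_isMinOn (Set.nonempty_Icc.2 zero_le_one)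
    (P.continuous_aeval (A := ℝ)).continuousOn (s := Set.Icc (0 : ℝ) 1)
  set δ : ℝ := aeval x₀ P
  have hδ : 0 < δ := hP x₀ hx₀
  set S : ℝ := ∑ j ∈ Finset.range (P.natDegree + 1), |(P.coeff j : ℝ)|
  have hS : 0 ≤ S := Finset.sum_nonneg fun _ _ => abs_nonneg _
  have hε : 0 < δ / (S + 1) := by positivity
  obtain ⟨n, hn, hn0⟩ := (((Finset.range (P.natDegree + 1)).eventually_all.2 fun j _ =>
    eventually_abs_choose_div_choose_sub_pow_le j _ hε).and
      (Filter.eventually_ge_atTop (P.natDegree + 1))).exists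
  have hb : ∀ i ≤ n, 0 ≤ ∑ j ∈ Finset.range (P.natDegree + 1),
        P.coeff j * ((i.choose j : ℚ) / n.choose j) := by
    intro i hi
    have hnpos : (0 : ℝ) < n := by exact_mod_cast (Nat.succ_pos _).trans_le hn0
    have hy : (i : ℝ) / n ∈ Set.Icc (0 : ℝ) 1 :=
      ⟨by positivity, div_le_one_of_le₀ (by exact_mod_cast hi) hnpos.le⟩
    have hle : δ ≤ aeval ((i : ℝ) / n) P := hmin hy
    rw [aeval_eq_sum_range] at hle
    have hdiff : |∑ j ∈ Finset.range (P.natDegree + 1),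
        (P.coeff j : ℝ) * ((i.choose j : ℝ) / n.choose j) -
          ∑ j ∈ Finset.range (P.natDegree + 1), P.coeff j • ((i : ℝ) / n) ^ j| ≤
        S * (δ / (S + 1)) := by
      rw [← Finset.sum_sub_distrib, Finset.sum_mul]
      refine (Finset.abs_sum_le_sum_abs _ _).trans (Finset.sum_le_sum fun j hj => ?_)
      rw [Rat.smul_def, ← mul_sub, abs_mul]
      exact mul_le_mul_of_nonneg_left (hn j hj i hi) (abs_nonneg _)
    have hlt : S * (δ / (S + 1)) ≤ δ := by
      rw [mul_div_assoc', div_le_iff₀ (by positivity)]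
      nlinarith
    have := (abs_le.1 hdiff).1
    have hreal : (0 : ℝ) ≤ ∑ j ∈ Finset.range (P.natDegree + 1),
        (P.coeff j : ℝ) * ((i.choose j : ℝ) / n.choose j) := by linarith
    rw [← Rat.cast_nonneg (K := ℝ)]
    push_cast
    exact hreal
  refine ⟨n, fun i => if i ≤ n then n.choose i * ∑ j ∈ Finset.range (P.natDegree + 1),
        P.coeff j * ((i.choose j : ℚ) / n.choose j) else 0, fun i => ?_, ?_⟩
  · dsimp only
    split_ifs with hi
    exacts [mul_nonneg (by positivity) (hb i hi), le_rfl]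
  · refine (P.eq_sum_bernstein_form (by omega : P.natDegree ≤ n)).trans
      (Finset.sum_congr rfl fun i hi => ?_)
    dsimp only
    rw [if_pos (Nat.lt_succ_iff.1 (Finset.mem_range.1 hi))]

/-- Bernstein's theorem on polynomials which are positive on the open unit interval. -/
theorem exists_hasNonnegBernsteinForm_of_pos_Ioo (P : ℚ[X])
    (hP : ∀ x ∈ Set.Ioo (0 : ℝ) 1, 0 < aeval x P) : ∃ n, HasNonnegBernsteinForm n P := by
  induction hd : P.natDegree using Nat.strong_induction_on generalizing P with
  | _ d ih =>
    have hP0 : P ≠ 0 := by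
      rintro rfl
      simpa using hP (1 / 2) (by norm_num)
    by_cases h0 : P.eval 0 = 0
    · obtain ⟨Q, rfl⟩ : X ∣ P := by rwa [X_dvd_iff, coeff_zero_eq_eval_zero]
      have hQ0 : Q ≠ 0 := right_ne_zero_of_mul hP0
      obtain ⟨n, hn⟩ := ih Q.natDegree (by rw [← hd, natDegree_X_mul hQ0]; omega) Q
        (fun x hx => by
          have := hP x hx
          rw [map_mul, aeval_X] at this
          exact pos_of_mul_pos_right this hx.1.le) rfl
      exact ⟨n + 1, hn.X_mul⟩
    by_cases h1 : P.eval 1 = 0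
    · obtain ⟨R, hR⟩ : X - C 1 ∣ P := dvd_iff_isRoot.2 h1
      obtain ⟨Q, rfl⟩ : ∃ Q, P = (1 - X) * Q := ⟨-R, by rw [hR, C_1]; ring⟩
      have hQ0 : Q ≠ 0 := right_ne_zero_of_mul hP0
      have hdeg : (1 - X : ℚ[X]).natDegree = 1 := by
        rw [← neg_sub, natDegree_neg, ← C_1, natDegree_X_sub_C]
      obtain ⟨n, hn⟩ := ih Q.natDegree
        (by rw [← hd, natDegree_mul (left_ne_zero_of_mul hP0) hQ0, hdeg]; omega) Q
        (fun x hx => by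
          have := hP x hx
          rw [map_mul, map_sub, map_one, aeval_X] at this
          exact pos_of_mul_pos_right this (sub_nonneg.2 hx.2.le)) rfl
      exact ⟨n + 1, hn.one_sub_X_mul⟩
    refine exists_hasNonnegBernsteinForm_of_pos_Icc P fun x hx => ?_
    have hnonneg : 0 ≤ aeval x P := by
      have hcl : x ∈ closure (Set.Ioo (0 : ℝ) 1) := by rwa [closure_Ioo zero_ne_one]
      exact closure_minimal (fun y hy => (hP y hy).le)
        (isClosed_Ici.preimage (P.continuous_aeval (A := ℝ))) hcl
    refine lt_of_le_of_ne hnonneg (Ne.symm ?_)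
    rcases hx.1.eq_or_lt with rfl | hx0
    · rw [← map_zero (algebraMap ℚ ℝ), aeval_algebraMap_apply_eq_algebraMap_eval]
      simpa using h0
    rcases hx.2.eq_or_lt with rfl | hx1
    · rw [← map_one (algebraMap ℚ ℝ), aeval_algebraMap_apply_eq_algebraMap_eval]
      simpa using h1
    exact (hP x ⟨hx0, hx1⟩).ne'

end Polynomial

theorem Finset.exists_pos_mul_eq_intCast {ι : Type*} (s : Finset ι) (f : ι → ℚ) :
    ∃ M : ℕ, 0 < M ∧ ∀ i ∈ s, ∃ z : ℤ, (M : ℚ) * f i = z := by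
  refine ⟨∏ i ∈ s, (f i).den, Finset.prod_pos fun i _ => (f i).den_pos, fun i hi => ?_⟩
  obtain ⟨t, ht⟩ := Finset.dvd_prod_of_mem (fun i => (f i).den) hi
  refine ⟨t * (f i).num, ?_⟩
  rw [ht]
  push_cast
  rw [mul_comm ((f i).den : ℚ), mul_assoc, mul_comm ((f i).den : ℚ), Rat.mul_den_eq_num]

theorem stmt_7 (g h : Polynomial ℚ)
    (hgh : ∀ x ∈ Set.Ioo (0:ℝ) 1, Polynomial.aeval x h ≠ 0 ∧
      0 < Polynomial.aeval x g / Polynomial.aeval x h ∧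
      Polynomial.aeval x g / Polynomial.aeval x h < 1) :
    ∃ (k : ℕ) (d e : ℕ → ℤ),
      (∀ i ≤ k, 0 ≤ d i ∧ d i ≤ e i) ∧
      (∃ i ≤ k, e i ≠ 0) ∧
      ∀ p ∈ Set.Ioo (0:ℝ) 1,
        Polynomial.aeval p g / Polynomial.aeval p h =
          (∑ i ∈ Finset.range (k + 1), (d i : ℝ) * p ^ i * (1 - p) ^ (k - i)) /
          (∑ i ∈ Finset.range (k + 1), (e i : ℝ) * p ^ i * (1 - p) ^ (k - i)) := by
  open Polynomial in
  have hsq : ∀ x ∈ Set.Ioo (0 : ℝ) 1, 0 < aeval x h ^ 2 := fun x hx =>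
    sq_pos_of_ne_zero (hgh x hx).1
  have hquot : ∀ x ∈ Set.Ioo (0 : ℝ) 1,
      aeval x g * aeval x h = aeval x g / aeval x h * aeval x h ^ 2 := fun x hx => by
    have := (hgh x hx).1
    field_simp
  obtain ⟨n₁, hn₁⟩ := exists_hasNonnegBernsteinForm_of_pos_Ioo (g * h) fun x hx => by
    rw [map_mul, hquot x hx]
    exact mul_pos (hgh x hx).2.1 (hsq x hx)
  obtain ⟨n₂, hn₂⟩ := exists_hasNonnegBernsteinForm_of_pos_Ioo (h ^ 2 - g * h) fun x hx => by
    rw [map_sub, map_pow, map_mul, hquot x hx]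
    nlinarith [(hgh x hx).2.2, hsq x hx]
  obtain ⟨a, ha, hga⟩ := hn₁.mono (le_max_left n₁ n₂)
  obtain ⟨b, hb, hhb⟩ := hn₂.mono (le_max_right n₁ n₂)
  set k := max n₁ n₂
  obtain ⟨M, hM, hMa⟩ := (Finset.range (k + 1)).exists_pos_mul_eq_intCast a
  obtain ⟨N, hN, hNb⟩ := (Finset.range (k + 1)).exists_pos_mul_eq_intCast b
  choose! u hu using hMa
  choose! v hv using hNb
  have hMN : (0 : ℝ) < N * M := by positivity
  have hd : ∀ p : ℝ, ∑ i ∈ Finset.range (k + 1),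
      ((N * u i : ℤ) : ℝ) * p ^ i * (1 - p) ^ (k - i) = N * M * (aeval p g * aeval p h) := by
    intro p
    rw [← map_mul, hga, map_sum, Finset.mul_sum]
    refine Finset.sum_congr rfl fun i hi => ?_
    have : (u i : ℝ) = M * a i := by exact_mod_cast (hu i hi).symm
    simp [this]
    ring
  have he : ∀ p : ℝ, ∑ i ∈ Finset.range (k + 1),
      ((N * u i + M * v i : ℤ) : ℝ) * p ^ i * (1 - p) ^ (k - i) = N * M * aeval p h ^ 2 := by
    intro p
    have h2 : aeval p h ^ 2 = aeval p g * aeval p h + aeval p (h ^ 2 - g * h) := by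
      rw [map_sub, map_pow, map_mul]
      ring
    rw [h2, mul_add, ← hd, hhb, map_sum, Finset.mul_sum, ← Finset.sum_add_distrib]
    refine Finset.sum_congr rfl fun i hi => ?_
    have : (v i : ℝ) = N * b i := by exact_mod_cast (hv i hi).symm
    simp [this]
    ring
  refine ⟨k, fun i => N * u i, fun i => N * u i + M * v i, fun i hi => ?_, ?_, fun p hp => ?_⟩
  · have hi' : i ∈ Finset.range (k + 1) := Finset.mem_range.2 (Nat.lt_succ_of_le hi)
    have hu0 : 0 ≤ u i := by
      have : (0 : ℚ) ≤ u i := hu i hi' ▸ mul_nonneg M.cast_nonneg (ha i)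
      exact_mod_cast this
    have hv0 : 0 ≤ v i := by
      have : (0 : ℚ) ≤ v i := hv i hi' ▸ mul_nonneg N.cast_nonneg (hb i)
      exact_mod_cast this
    exact ⟨by positivity, le_add_of_nonneg_right (by positivity)⟩
  · by_contra! hzero
    have hhalf : (1 / 2 : ℝ) ∈ Set.Ioo (0 : ℝ) 1 := by norm_num
    have hpos := mul_pos hMN (hsq _ hhalf)
    rw [← he, Finset.sum_eq_zero] at hpos
    · exact hpos.false
    · intro i hi
      rw [hzero i (Nat.lt_succ_iff.1 (Finset.mem_range.1 hi))]
      simp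
  · rw [hd, he, mul_div_mul_left _ _ hMN.ne', sq, mul_div_mul_right _ _ (hgh p hp).1]
end

section
/- Let s, t ≥ 1, let Σ = Fin (s+1), and let f = (f₁,…,f_{t+1}) : Δ^s → Δ^t, i.e. fᵢ(p) > 0 for all i and ∑_{i=1}^{t+1} fᵢ(p) = 1 for all p ∈ Δ^s. Suppose there exist pairwise disjoint regular languages L₁,…,L_{t+1} over Σ such that ⋃ᵢ Lᵢ has the prefix property and, for every p ∈ Δ^s, ∑_{i=1}^{t+1} P_p(Lᵢ) = 1 and P_p(Lᵢ) = fᵢ(p) for each i. Then each fᵢ is a rational function over ℚ: there exist polynomials gᵢ, hᵢ ∈ ℚ[x₁,…,x_{s+1}] such that hᵢ(p) ≠ 0 and fᵢ(p) = gᵢ(p)/hᵢ(p) for every p ∈ Δ^s. -/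
/-- The open simplex of probability vectors with strictly positive coordinates. -/
def openSimplex (s : ℕ) : Set (Fin (s + 1) → ℝ) :=
  {p | (∀ i, 0 < p i) ∧ ∑ i, p i = 1}

/-- Probability of a word over the alphabet `Fin (s+1)` under i.i.d. `p`-distributed letters. -/
def wordProbF {s : ℕ} (p : Fin (s + 1) → ℝ) (w : List (Fin (s + 1))) : ℝ :=
  (w.map p).prod

/-- Probability of a language over the alphabet `Fin (s+1)`. -/
noncomputable def langProbF {s : ℕ} (p : Fin (s + 1) → ℝ)
    (L : Set (List (Fin (s + 1)))) : ℝ :=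
  ∑' w : L, wordProbF p (w : List (Fin (s + 1)))

/-- A language has the prefix property if no word of it is a proper prefix
of another word of it. -/
def PrefixFreeF {s : ℕ} (L : Set (List (Fin (s + 1)))) : Prop :=
  ∀ u ∈ L, ∀ v ∈ L, u ≠ v → ¬ u <+: v

namespace List

/-- A word is either empty or a first letter followed by a word. -/
def unitSumProdEquiv (α : Type*) : Unit ⊕ α × List α ≃ List α where
  toFun := Sum.elim (fun _ => []) fun x => x.1 :: x.2
  invFun w := match w with
    | [] => Sum.inl ()
    | a :: w => Sum.inr (a, w)
  left_inv x := by rcases x with _ | _ <;> rfl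
  right_inv w := by cases w <;> rfl

theorem tsum_eq_nil_add_sum_cons {α : Type*} [Fintype α] {F : List α → ℝ} (hF : Summable F) :
    ∑' w, F w = F [] + ∑ a, ∑' w, F (a :: w) := by
  have h : Summable (fun x => F (unitSumProdEquiv α x)) :=
    (unitSumProdEquiv α).summable_iff.2 hF
  have hr : Summable (fun x : α × List α => F (x.1 :: x.2)) := h.comp_injective Sum.inr_injective
  rw [← (unitSumProdEquiv α).tsum_eq F,
    Summable.tsum_sum (h.comp_injective Sum.inl_injective) hr]
  refine congrArg₂ _ (by simp [unitSumProdEquiv]) ?_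
  exact hr.tsum_prod.trans (tsum_fintype _)

end List

section

variable {s : ℕ} {p : Fin (s + 1) → ℝ} {L : Language (Fin (s + 1))}

theorem langProbF_eq_tsum_indicator (p : Fin (s + 1) → ℝ) (L : Language (Fin (s + 1))) :
    langProbF p L = ∑' w, Set.indicator L (wordProbF p) w :=
  tsum_subtype L (wordProbF p)

theorem wordProbF_pos (hp : ∀ a, 0 < p a) (w : List (Fin (s + 1))) : 0 < wordProbF p w := by
  refine List.prod_pos fun x hx => ?_
  obtain ⟨a, -, rfl⟩ := List.mem_map.1 hx
  exact hp a

theorem indicator_wordProbF_append (L : Language (Fin (s + 1))) (u w : List (Fin (s + 1))) :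
    Set.indicator L (wordProbF p) (u ++ w) =
      wordProbF p u * Set.indicator (L.leftQuotient u) (wordProbF p) w := by
  have h : w ∈ (L.leftQuotient u : Set (List (Fin (s + 1)))) ↔
    u ++ w ∈ (L : Set (List (Fin (s + 1)))) := Iff.rfl
  by_cases hw : u ++ w ∈ (L : Set (List (Fin (s + 1))))
  · rw [Set.indicator_of_mem hw, Set.indicator_of_mem (h.2 hw)]
    simp [wordProbF]
  · rw [Set.indicator_of_notMem hw, Set.indicator_of_notMem (mt h.1 hw), mul_zero]

theorem summable_leftQuotient (hp : ∀ a, 0 < p a) (hL : Summable (Set.indicator L (wordProbF p)))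
    (u : List (Fin (s + 1))) :
    Summable (Set.indicator (L.leftQuotient u) (wordProbF p)) := by
  have h := hL.comp_injective (List.append_right_injective u)
  simp only [Function.comp_def, indicator_wordProbF_append] at h
  exact (summable_mul_left_iff (wordProbF_pos hp u).ne').1 h

open Classical in
theorem langProbF_eq_nil_add_sum (hL : Summable (Set.indicator L (wordProbF p))) :
    langProbF p L = (if [] ∈ L then 1 else 0) + ∑ a, p a * langProbF p (L.leftQuotient [a]) := by
  rw [langProbF_eq_tsum_indicator, List.tsum_eq_nil_add_sum_cons hL]
  refine congrArg₂ _ rfl (Finset.sum_congr rfl fun a _ => ?_)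
  rw [langProbF_eq_tsum_indicator, ← tsum_mul_left]
  refine tsum_congr fun w => ?_
  simpa [wordProbF] using indicator_wordProbF_append (p := p) L [a] w

open Classical MvPolynomial in
/-- The weighted transition matrix between the left quotients of `L`, without the transitions
into the empty language. -/
noncomputable def transitionMatrix (L : Language (Fin (s + 1))) :
    Matrix (Set.range L.leftQuotient) (Set.range L.leftQuotient) (MvPolynomial (Fin (s + 1)) ℚ) :=
  Matrix.of fun K K' => ∑ a, if L.toDFA.step K a = K' ∧ K'.val ≠ 0 then X a else 0

theorem map_transitionMatrix_mulVec [Fintype (Set.range L.leftQuotient)]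
    {v : Set.range L.leftQuotient → ℝ}
    {K : Set.range L.leftQuotient} (hv : ∀ K, K.val = 0 → v K = 0) :
    ((transitionMatrix L).map (MvPolynomial.aeval p)).mulVec v K =
      ∑ a, p a * v (L.toDFA.step K a) := by
  classical
  simp only [Matrix.mulVec, dotProduct, Matrix.map_apply, transitionMatrix, Matrix.of_apply,
    map_sum, Finset.sum_mul]
  rw [Finset.sum_comm]
  refine Finset.sum_congr rfl fun a _ => ?_
  rw [Finset.sum_eq_single (L.toDFA.step K a)]
  · by_cases h : (L.toDFA.step K a).val = 0
    · rw [hv _ h, mul_zero, mul_zero]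
    · rw [if_pos ⟨rfl, h⟩, MvPolynomial.aeval_X]
  · intro K' _ hK'
    rw [if_neg fun h => hK' h.1.symm, map_zero, zero_mul]
  · simp

theorem map_transitionMatrix_mulVec_zero [Fintype (Set.range L.leftQuotient)]
    {v : Set.range L.leftQuotient → ℝ} {K : Set.range L.leftQuotient} (hK : K.val = 0) :
    ((transitionMatrix L).map (MvPolynomial.aeval p)).mulVec v K = 0 := by
  classical
  simp only [Matrix.mulVec, dotProduct, Matrix.map_apply, transitionMatrix, Matrix.of_apply]
  refine Finset.sum_eq_zero fun K' _ => ?_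
  rw [Finset.sum_eq_zero, map_zero, zero_mul]
  intro a _
  rw [if_neg]
  rintro ⟨rfl, h⟩
  refine h (Set.eq_empty_iff_forall_notMem.2 fun w hw => ?_)
  have : a :: w ∈ K.val := hw
  rw [hK] at this
  exact this

/-- Maximum principle: on a prefix-free language, a function on the left quotients that is
harmonic and vanishes at the empty language is zero. -/
theorem eq_zero_of_harmonic [Finite (Set.range L.leftQuotient)] (hp : p ∈ openSimplex s)
    (hL : PrefixFreeF L)
    {v : Set.range L.leftQuotient → ℝ} (hv : ∀ K, K.val = 0 → v K = 0)
    (h : ∀ K, v K = ∑ a, p a * v (L.toDFA.step K a)) : v = 0 := by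
  have : Nonempty (Set.range L.leftQuotient) := ⟨L.toDFA.start⟩
  obtain ⟨K, hK⟩ := Finite.exists_max fun K => |v K|
  by_contra hne
  have hpos : 0 < |v K| := by
    obtain ⟨K', hK'⟩ := Function.ne_iff.1 hne
    exact (abs_pos.2 hK').trans_le (hK K')
  have hstep : ∀ K', |v K'| = |v K| → ∀ a, |v (L.toDFA.step K' a)| = |v K| := by
    intro K' hK' a
    by_contra ha
    have hlt : ∑ b, p b * |v (L.toDFA.step K' b)| < ∑ b, p b * |v K| :=
      Finset.sum_lt_sum (fun b _ => mul_le_mul_of_nonneg_left (hK _) (hp.1 b).le)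
        ⟨a, Finset.mem_univ a, mul_lt_mul_of_pos_left (lt_of_le_of_ne (hK _) ha) (hp.1 a)⟩
    rw [← Finset.sum_mul, hp.2, one_mul, ← hK', h K'] at hlt
    refine hlt.not_ge ((Finset.abs_sum_le_sum_abs _ _).trans_eq ?_)
    simp only [abs_mul, abs_of_pos (hp.1 _)]
  have heval : ∀ w, |v (L.toDFA.evalFrom K w)| = |v K| := by
    intro w
    induction w using List.reverseRecOn with
    | nil => rfl
    | append_singleton w a ih =>
      rw [DFA.evalFrom_append_singleton]
      exact hstep _ ih a
  have hnonempty : ∀ w, ∃ x, w ++ x ∈ K.val := by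
    intro w
    have hval : (L.toDFA.evalFrom K w).val = K.val.leftQuotient w := by
      induction w using List.reverseRecOn with
      | nil => rfl
      | append_singleton w a ih =>
        rw [DFA.evalFrom_append_singleton, Language.step_toDFA, ih, Language.leftQuotient_append]
    by_contra! hempty
    have hzero := hv (L.toDFA.evalFrom K w)
      (hval.trans (Set.eq_empty_iff_forall_notMem.2 hempty))
    have := heval w
    rw [hzero, abs_zero] at this
    exact hpos.ne this
  obtain ⟨u, hu⟩ := K.2
  obtain ⟨w, hw⟩ := hnonempty []
  obtain ⟨x, hx⟩ := hnonempty (w ++ [0])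
  rw [← hu] at hw hx
  refine hL (u ++ w) hw (u ++ (w ++ [0] ++ x)) hx ?_ ⟨[0] ++ x, by simp⟩
  intro heq
  simpa using congrArg List.length heq

/-- The probability of a regular prefix-free language is a rational function of the letter
probabilities. -/
theorem exists_langProbF_eq_div (hreg : L.IsRegular) (hL : PrefixFreeF L)
    (hsum : ∀ p ∈ openSimplex s, Summable (Set.indicator L (wordProbF p))) :
    ∃ g h : MvPolynomial (Fin (s + 1)) ℚ, ∀ p ∈ openSimplex s,
      MvPolynomial.aeval p h ≠ 0 ∧
        langProbF p L = MvPolynomial.aeval p g / MvPolynomial.aeval p h := by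
  classical
  have := hreg.finite_range_leftQuotient.fintype
  let M := 1 - transitionMatrix L
  let b : Set.range L.leftQuotient → MvPolynomial (Fin (s + 1)) ℚ :=
    fun K => if [] ∈ K.val then 1 else 0
  refine ⟨M.adjugate.mulVec b L.toDFA.start, M.det, fun p hp => ?_⟩
  let φ : MvPolynomial (Fin (s + 1)) ℚ →+* ℝ := (MvPolynomial.aeval p).toRingHom
  have hM : φ.mapMatrix M = 1 - (transitionMatrix L).map (MvPolynomial.aeval p) := by
    rw [map_sub, map_one]
    rfl
  have hdet : φ M.det ≠ 0 := by
    rw [RingHom.map_det, Ne, ← Matrix.exists_mulVec_eq_zero_iff]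
    rintro ⟨v, hv0, hv⟩
    rw [hM, Matrix.sub_mulVec, Matrix.one_mulVec, sub_eq_zero] at hv
    have hzero : ∀ K, K.val = 0 → v K = 0 := fun K hK => by
      rw [hv, map_transitionMatrix_mulVec_zero hK]
    refine hv0 (eq_zero_of_harmonic hp hL hzero fun K => ?_)
    rw [← map_transitionMatrix_mulVec hzero, ← hv]
  refine ⟨hdet, (eq_div_iff hdet).2 ?_⟩
  let x : Set.range L.leftQuotient → ℝ := fun K => langProbF p K.val
  have hx0 : ∀ K, K.val = 0 → x K = 0 := by
    intro K hK
    simp only [x, hK, langProbF_eq_tsum_indicator]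
    exact (tsum_congr fun w => Set.indicator_of_notMem id _).trans tsum_zero
  have hx : (φ.mapMatrix M).mulVec x = φ ∘ b := by
    rw [hM, Matrix.sub_mulVec, Matrix.one_mulVec]
    ext K
    rw [Pi.sub_apply, map_transitionMatrix_mulVec hx0, sub_eq_iff_eq_add]
    obtain ⟨K, u, rfl⟩ := K
    refine (langProbF_eq_nil_add_sum (summable_leftQuotient hp.1 (hsum p hp) u)).trans ?_
    congr 1
    simp only [Function.comp_apply, b, apply_ite φ, map_one, map_zero]
  have hsolve := congrArg ((φ.mapMatrix M).adjugate.mulVec) hx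
  rw [Matrix.mulVec_mulVec, Matrix.adjugate_mul, Matrix.smul_mulVec, Matrix.one_mulVec,
    ← RingHom.map_det, ← RingHom.map_adjugate] at hsolve
  have hstart := congrFun hsolve L.toDFA.start
  rw [mul_comm]
  refine hstart.trans ?_
  exact (RingHom.map_mulVec φ _ _ _).symm

end

theorem stmt_9 (s t : ℕ) (hs : 1 ≤ s) (ht : 1 ≤ t)
    (f : Fin (t + 1) → (Fin (s + 1) → ℝ) → ℝ)
    (hfpos : ∀ p ∈ openSimplex s, ∀ i, 0 < f i p)
    (hfsum : ∀ p ∈ openSimplex s, ∑ i, f i p = 1)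
    (L : Fin (t + 1) → Set (List (Fin (s + 1))))
    (hreg : ∀ i, Language.IsRegular (L i : Language (Fin (s + 1))))
    (hdisj : ∀ i j, i ≠ j → Disjoint (L i) (L j))
    (hpre : PrefixFreeF (⋃ i, L i))
    (htotal : ∀ p ∈ openSimplex s, ∑ i, langProbF p (L i) = 1)
    (hsim : ∀ p ∈ openSimplex s, ∀ i, langProbF p (L i) = f i p) :
    ∀ i, ∃ g h : MvPolynomial (Fin (s + 1)) ℚ,
      ∀ p ∈ openSimplex s,
        MvPolynomial.aeval p h ≠ 0 ∧
        f i p = MvPolynomial.aeval p g / MvPolynomial.aeval p h := by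
  intro i
  have hpreL : PrefixFreeF (L i) := fun u hu v hv =>
    hpre u (Set.mem_iUnion_of_mem i hu) v (Set.mem_iUnion_of_mem i hv)
  have hsum : ∀ p ∈ openSimplex s, Summable (Set.indicator (L i) (wordProbF p)) := by
    intro p hp
    by_contra hns
    have hpos := hfpos p hp i
    rw [← hsim p hp i, langProbF_eq_tsum_indicator p (L i), tsum_eq_zero_of_not_summable hns]
      at hpos
    exact hpos.false
  obtain ⟨g, h, hgh⟩ := exists_langProbF_eq_div (hreg i) hpreL hsum
  exact ⟨g, h, fun p hp => ⟨(hgh p hp).1, (hsim p hp i).symm.trans (hgh p hp).2⟩⟩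
end

section
/- Let n, m ≥ 1, let F₁,…,F_m ∈ ℚ[p, x₁,…,x_n] be polynomials, and let S ⊆ ℝ^{n+1} be the set S = {(p, x₁,…,x_n) : 0 < p < 1, 0 ≤ xⱼ ≤ 1 for all j, and Fᵢ(p,x₁,…,x_n) = 0 for all i}. Suppose φ : (0,1) → [0,1]^n is a function such that for every p ∈ (0,1), the point (p, φ₁(p),…,φ_n(p)) lies in S and is the unique point of S with first coordinate p (i.e., for every x ∈ ℝ^n with 0 ≤ xⱼ ≤ 1 for all j and Fᵢ(p,x) = 0 for all i, one has x = φ(p)). Then for every j ∈ {1,…,n} there exists a nonzero polynomial gⱼ ∈ ℚ[X,Y] such that gⱼ(p, φⱼ(p)) = 0 for all p ∈ (0,1). -/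
open Polynomial in
theorem isAlgebraic_of_smul_pow_eq_aeval {R A σ : Type*} [CommRing R] [IsDomain R] [CommRing A]
    [Algebra R A] [Fintype σ] {c : R} (hc : c ≠ 0) {e : ℕ} {q : σ → MvPolynomial σ R}
    (hq : ∀ k, (q k).totalDegree < e) {z : σ → A}
    (hz : ∀ k, c • z k ^ e = MvPolynomial.aeval z (q k)) (k : σ) : IsAlgebraic R (z k) := by
  classical
  let mon : (σ →₀ ℕ) → A := fun a => a.prod fun i n => z i ^ n
  have mon_add (a b : σ →₀ ℕ) : mon (a + b) = mon a * mon b :=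
    Finsupp.prod_add_index' (fun _ => pow_zero _) (fun _ _ _ => pow_add _ _ _)
  have mon_single (i : σ) (n : ℕ) : mon (Finsupp.single i n) = z i ^ n :=
    Finsupp.prod_single_index (pow_zero _)
  let small : Set (σ →₀ ℕ) := {a | ∀ i, a i < e}
  have small_finite : small.Finite := by
    refine (Set.finite_Iic (Finsupp.equivFunOnFinite.symm fun _ : σ => e)).subset fun a ha i => ?_
    exact (ha i).le
  let W : Submodule R A := Submodule.span R (mon '' small)
  have : Module.Finite R W :=
    Module.Finite.iff_fg.mpr (Submodule.fg_span (small_finite.image mon))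
  have key : ∀ d (a : σ →₀ ℕ), a.degree ≤ d → c ^ d • mon a ∈ W := by
    intro d
    induction d with
    | zero =>
      intro a ha
      have ha0 : a = 0 := (Finsupp.degree_eq_zero_iff a).mp (Nat.le_zero.mp ha)
      refine W.smul_mem _ (Submodule.subset_span ⟨a, fun i => ?_, rfl⟩)
      rw [ha0]
      exact (Nat.zero_le _).trans_lt (hq i)
    | succ d ih =>
      intro a ha
      by_cases hs : a ∈ small
      · exact W.smul_mem _ (Submodule.subset_span ⟨a, hs, rfl⟩)
      obtain ⟨i, hi⟩ : ∃ i, e ≤ a i := by simpa [small] using hs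
      obtain ⟨b, rfl⟩ : ∃ b, a = b + Finsupp.single i e :=
        ⟨a - Finsupp.single i e, (tsub_add_cancel_of_le (Finsupp.single_le_iff.mpr hi)).symm⟩
      have hb : b.degree + e ≤ d + 1 := by simpa using ha
      have h1 : c ^ (d + 1) • mon (b + Finsupp.single i e) =
          ∑ m ∈ (q i).support, (q i).coeff m • (c ^ d • mon (b + m)) := by
        rw [mon_add, mon_single, pow_succ, mul_smul, ← mul_smul_comm, hz,
          MvPolynomial.aeval_def, MvPolynomial.eval₂_eq, Finset.mul_sum, Finset.smul_sum]
        refine Finset.sum_congr rfl fun m _ => ?_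
        have : mon m = ∏ j ∈ m.support, z j ^ m j := rfl
        rw [mon_add, ← this, smul_comm, Algebra.smul_def ((q i).coeff m), mul_left_comm,
          Algebra.smul_def]
      rw [h1]
      refine W.sum_mem fun m hm => W.smul_mem _ (ih _ ?_)
      have h2 : m.degree ≤ (q i).totalDegree := MvPolynomial.le_totalDegree hm
      have h3 := hq i
      rw [map_add]
      omega
  have pow_mem (n : ℕ) : (c • z k) ^ n ∈ W := by
    have := key n (Finsupp.single k n) (by simp)
    rwa [mon_single, ← _root_.smul_pow] at this
  have hnot : ¬ LinearIndependent R fun n : ℕ => (⟨(c • z k) ^ n, pow_mem n⟩ : W) := fun h =>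
    Infinite.not_finite (α := ℕ) h.finite
  have halg : IsAlgebraic R (c • z k) := by
    by_contra htr
    apply hnot
    have h1 : LinearIndependent R fun n : ℕ => (c • z k) ^ n := by
      have hker : LinearMap.ker (Polynomial.aeval (R := R) (c • z k)).toLinearMap = ⊥ :=
        LinearMap.ker_eq_bot'.mpr (transcendental_iff.mp htr)
      simpa [Function.comp_def] using
        (Polynomial.basisMonomials R).linearIndependent.map' _ hker
    exact LinearIndependent.of_comp W.subtype h1
  obtain ⟨p, hp, hp0⟩ := halg
  refine ⟨p.comp (C c * X), ?_, ?_⟩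
  · rw [Ne, Polynomial.comp_eq_zero_iff]
    rintro (h | ⟨-, h⟩)
    · exact hp h
    · exact hc (by simpa using congr_arg (Polynomial.coeff · 1) h)
  · simpa [Polynomial.aeval_comp, Algebra.smul_def] using hp0

theorem MvPolynomial.hasDerivAt_eval₂_update {P σ : Type*} [CommRing P] [DecidableEq σ]
    (θ : P →+* ℝ) (Q : MvPolynomial σ P) (z : σ → ℝ) (k : σ) :
    HasDerivAt (fun t => Q.eval₂ θ (Function.update z k t))
      ((pderiv k Q).eval₂ θ z) (z k) := by
  induction Q using MvPolynomial.induction_on with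
  | C a => simpa using hasDerivAt_const _ _
  | add p q hp hq => simpa using hp.fun_add hq
  | mul_X p i hp =>
    have hX : HasDerivAt (fun t : ℝ => Function.update z k t i) ((Pi.single k 1 : σ → ℝ) i) (z k) :=
      hasDerivAt_pi.mp (hasDerivAt_update z k (z k)) i
    have := hp.fun_mul hX
    simp only [Function.update_eq_self] at this
    have hsingle : (pderiv k (X i : MvPolynomial σ P)).eval₂ θ z = (Pi.single k 1 : σ → ℝ) i := by
      rw [pderiv_X]
      by_cases h : i = k
      · subst h; simp
      · simp [h]
    simp only [pderiv_mul, eval₂_add, eval₂_mul, eval₂_X, hsingle]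
    exact this

open Filter Topology in
theorem exists_minimizer_add_smul_sum_pow {σ : Type*} [Fintype σ] {f : (σ → ℝ) → ℝ}
    (hf : Continuous f) (hf0 : ∀ z, 0 ≤ f z) {w : σ → ℝ} (hw : f w = 0) {D : ℕ} (hD : D ≠ 0) :
    ∃ K : Set (σ → ℝ), IsCompact K ∧ ∃ M : ℝ, ∀ ε > 0, ∃ z ∈ K, f z ≤ ε * M ∧
      ∀ y, f z + ε * ∑ k, z k ^ (2 * D) ≤ f y + ε * ∑ k, y k ^ (2 * D) := by
  set M := ∑ k, w k ^ (2 * D)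
  have hnn (z : σ → ℝ) (k : σ) : 0 ≤ z k ^ (2 * D) := (even_two_mul D).pow_nonneg _
  have hcont : Continuous fun z : σ → ℝ => ∑ k, z k ^ (2 * D) := by fun_prop
  let K : Set (σ → ℝ) := {z | ∑ k, z k ^ (2 * D) ≤ M}
  have hK : IsCompact K := by
    have hbox := isCompact_univ_pi fun _ : σ => isCompact_Icc (a := -max 1 M) (b := max 1 M)
    refine hbox.of_isClosed_subset (isClosed_le hcont continuous_const)
      fun z hz k _ => abs_le.mp ?_
    have h1 : z k ^ (2 * D) ≤ M :=
      (Finset.single_le_sum (fun i _ => hnn z i) (Finset.mem_univ k)).trans hz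
    rcases le_total |z k| 1 with h | h
    · exact h.trans (le_max_left _ _)
    · refine (le_self_pow₀ h (mul_ne_zero two_ne_zero hD)).trans ?_
      rw [(even_two_mul D).pow_abs]
      exact h1.trans (le_max_right _ _)
  have hwK : w ∈ K := le_refl M
  refine ⟨K, hK, M, fun ε hε => ?_⟩
  obtain ⟨z, hz, hmin⟩ := hK.exists_isMinOn ⟨w, hwK⟩
    (f := fun z => f z + ε * ∑ k, z k ^ (2 * D)) (by fun_prop)
  have hzw : f z + ε * ∑ k, z k ^ (2 * D) ≤ ε * M := by simpa [hw] using hmin hwK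
  refine ⟨z, hz, ?_, fun y => ?_⟩
  · have := mul_nonneg hε.le (Finset.sum_nonneg fun k (_ : k ∈ Finset.univ) => hnn z k)
    linarith
  · by_cases hy : y ∈ K
    · exact hmin hy
    · have h1 : M < ∑ k, y k ^ (2 * D) := not_le.mp hy
      have := mul_lt_mul_of_pos_left h1 hε
      linarith [hf0 y]

theorem MvPolynomial.eval₂_pderiv_eq_of_isMin {P σ : Type*} [CommRing P] [Fintype σ]
    (θ : P →+* ℝ) (Q : MvPolynomial σ P) {ε : ℝ} {d : ℕ} {z : σ → ℝ}
    (hz : ∀ y : σ → ℝ, Q.eval₂ θ z + ε * ∑ k, z k ^ d ≤ Q.eval₂ θ y + ε * ∑ k, y k ^ d) (k : σ) :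
    (d * ε) * z k ^ (d - 1) = (-pderiv k Q).eval₂ θ z := by
  classical
  let S : MvPolynomial σ ℝ := MvPolynomial.map θ Q + C ε * ∑ k, X k ^ d
  have hS (y : σ → ℝ) : S.eval₂ (RingHom.id ℝ) y = Q.eval₂ θ y + ε * ∑ k, y k ^ d := by
    simp [S, MvPolynomial.eval₂_map, MvPolynomial.eval₂_sum]
  have hd := MvPolynomial.hasDerivAt_eval₂_update (RingHom.id ℝ) S z k
  have h0 := IsLocalMin.hasDerivAt_eq_zero (Filter.Eventually.of_forall fun t => by
    simpa only [Function.update_eq_self, hS] using hz (Function.update z k t)) hd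
  have h1 : (pderiv k Q).eval₂ θ z + ε * (d * z k ^ (d - 1)) = 0 := by
    simpa [S, MvPolynomial.eval₂_map, MvPolynomial.pderiv_map, MvPolynomial.pderiv_X, Pi.single_apply,
      MvPolynomial.pderiv_pow, MvPolynomial.eval₂_sum] using h0
  rw [← MvPolynomial.coe_eval₂Hom, map_neg, MvPolynomial.coe_eval₂Hom]
  linarith

open Polynomial in
theorem Polynomial.exists_ne_zero_swap_eq_X_pow_mul {P : Type*} [CommRing P] [IsDomain P]
    {h : P[X][X]} (hh : h ≠ 0) : ∃ (v : ℕ) (H : P[X][X]), H.coeff 0 ≠ 0 ∧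
      Bivariate.swap h = X ^ v * H := by
  have h0 : Bivariate.swap h ≠ 0 := by simpa using hh
  obtain ⟨H, hH, hdvd⟩ := exists_eq_pow_rootMultiplicity_mul_and_not_dvd (Bivariate.swap h) h0 0
  simp only [map_zero, sub_zero] at hH hdvd
  exact ⟨_, H, fun h => hdvd (X_dvd_iff.mpr h), hH⟩

open Polynomial Filter Topology in
theorem MvPolynomial.exists_zero_and_eval₂_eq_zero {P σ : Type*} [CommRing P] [IsDomain P]
    [CharZero P] [Fintype σ] (Q : MvPolynomial σ P) (k : σ) :
    ∃ g : P[X], g ≠ 0 ∧ ∀ θ : P →+* ℝ, (∀ z, 0 ≤ Q.eval₂ θ z) → (∃ z, Q.eval₂ θ z = 0) →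
      ∃ z, Q.eval₂ θ z = 0 ∧ g.eval₂ θ (z k) = 0 := by
  let D : ℕ := 1 + ∑ i, (pderiv i Q).totalDegree
  have hD : D ≠ 0 := by omega
  let T := {w : (P →+* ℝ) × ℝ × (σ → ℝ) // ∀ i,
    (((2 * D : ℕ) : ℝ) * w.2.1) * w.2.2 i ^ (2 * D - 1) = (-pderiv i Q).eval₂ w.1 w.2.2}
  let _ : Algebra P[X] (T → ℝ) :=
    (RingHom.pi fun t : T => eval₂RingHom t.1.1 t.1.2.1).toAlgebra
  have halgMap (c : P[X]) (t : T) : algebraMap P[X] (T → ℝ) c t = c.eval₂ t.1.1 t.1.2.1 := rfl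
  let Z : σ → T → ℝ := fun i t => t.1.2.2 i
  obtain ⟨h, hh, hh0⟩ : IsAlgebraic P[X] (Z k) := by
    refine isAlgebraic_of_smul_pow_eq_aeval (c := Polynomial.C ((2 * D : ℕ) : P) * Polynomial.X)
      (e := 2 * D - 1) (q := fun i => MvPolynomial.map Polynomial.C (-pderiv i Q))
      ?_ (fun i => ?_) (fun i => ?_) k
    · exact mul_ne_zero (Polynomial.C_ne_zero.mpr (Nat.cast_ne_zero.mpr (by omega)))
        Polynomial.X_ne_zero
    · refine (Finset.sup_mono (support_map_subset _ _)).trans_lt (?_ : (-pderiv i Q).totalDegree < _)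
      rw [totalDegree_neg]
      have := Finset.single_le_sum (f := fun i => (pderiv i Q).totalDegree)
        (fun _ _ => Nat.zero_le _) (Finset.mem_univ i)
      omega
    · funext t
      have h1 := MvPolynomial.eval₂_comp_left (Pi.evalRingHom (fun _ : T => ℝ) t)
        ((algebraMap P[X] (T → ℝ)).comp Polynomial.C) Z (-pderiv i Q)
      have h2 : (Pi.evalRingHom (fun _ : T => ℝ) t).comp
          ((algebraMap P[X] (T → ℝ)).comp Polynomial.C) = t.1.1 := by
        ext a
        simp [halgMap]
      rw [h2] at h1
      rw [Algebra.smul_def, MvPolynomial.aeval_def, MvPolynomial.eval₂_map, Pi.mul_apply, halgMap]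
      refine Eq.trans ?_ h1.symm
      refine Eq.trans ?_ (t.2 i)
      rw [Polynomial.eval₂_mul, Polynomial.eval₂_C, Polynomial.eval₂_X, map_natCast]
      rfl
  obtain ⟨v, H, hH, hswap⟩ := Polynomial.exists_ne_zero_swap_eq_X_pow_mul hh
  refine ⟨H.coeff 0, hH, fun θ hpos ⟨w, hw⟩ => ?_⟩
  have hcomm (ε y : ℝ) : h.eval₂ (eval₂RingHom θ ε) y =
      (Bivariate.swap h).eval₂ (eval₂RingHom θ y) ε := by
    have : eval₂RingHom (eval₂RingHom θ ε) y =
        (eval₂RingHom (eval₂RingHom θ y) ε).comp (Bivariate.swap (R := P)).toRingHom := by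
      ext <;> simp [Bivariate.swap_apply]
    exact congr_arg (fun f => f h) this
  have hroot (ε : ℝ) (hε : ε ≠ 0) (z : σ → ℝ)
      (hz : ∀ i, (((2 * D : ℕ) : ℝ) * ε) * z i ^ (2 * D - 1) = (-pderiv i Q).eval₂ θ z) :
      H.eval₂ (eval₂RingHom θ (z k)) ε = 0 := by
    let t : T := ⟨(θ, ε, z), hz⟩
    have h1 : h.eval₂ (eval₂RingHom θ ε) (z k) = 0 := by
      have h2 := Polynomial.hom_eval₂ h (algebraMap P[X] (T → ℝ))
        (Pi.evalRingHom (fun _ : T => ℝ) t) (Z k)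
      rw [← Polynomial.aeval_def, hh0] at h2
      exact h2.symm
    rw [hcomm, hswap, Polynomial.eval₂_mul, Polynomial.eval₂_X_pow] at h1
    exact (mul_eq_zero.mp h1).resolve_left (pow_ne_zero _ hε)
  have hcontQ : Continuous fun z : σ → ℝ => Q.eval₂ θ z := by
    simp only [← MvPolynomial.eval_map]
    exact MvPolynomial.continuous_eval _
  obtain ⟨K, hK, M, hmin⟩ := exists_minimizer_add_smul_sum_pow hcontQ hpos hw hD
  choose z hzK hzM hz using fun n : ℕ => hmin (1 / ((n : ℝ) + 1)) Nat.one_div_pos_of_nat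
  obtain ⟨y, -, s, hs, hlim⟩ := hK.tendsto_subseq hzK
  have hε : Tendsto (fun n => 1 / ((s n : ℝ) + 1)) atTop (𝓝 0) :=
    tendsto_one_div_add_atTop_nhds_zero_nat.comp hs.tendsto_atTop
  refine ⟨y, le_antisymm ?_ (hpos y), ?_⟩
  · refine le_of_tendsto_of_tendsto ((hcontQ.tendsto y).comp hlim) ?_
      (Eventually.of_forall fun n => hzM (s n))
    simpa using hε.mul_const M
  · have hcontH : Continuous fun u : ℝ × ℝ => H.eval₂ (eval₂RingHom θ u.1) u.2 := by
      simp only [Polynomial.eval₂_eq_sum_range, coe_eval₂RingHom]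
      fun_prop
    have hlim2 : Tendsto (fun n => (z (s n) k, 1 / ((s n : ℝ) + 1))) atTop (𝓝 (y k, 0)) :=
      (((continuous_apply k).tendsto y).comp hlim).prodMk_nhds hε
    have h1 := (hcontH.tendsto (y k, 0)).comp hlim2
    have h2 : (fun u : ℝ × ℝ => H.eval₂ (eval₂RingHom θ u.1) u.2) ∘
        (fun n => (z (s n) k, 1 / ((s n : ℝ) + 1))) = fun _ => 0 := by
      funext n
      exact hroot _ Nat.one_div_pos_of_nat.ne' _
        (MvPolynomial.eval₂_pderiv_eq_of_isMin θ Q (hz (s n)))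
    rw [h2] at h1
    simpa [Polynomial.eval₂_at_zero] using tendsto_nhds_unique h1 tendsto_const_nhds

open Polynomial in
theorem Polynomial.exists_mvPolynomial_fin_two {R : Type*} [CommRing R] {g : R[X][X]} (hg : g ≠ 0) :
    ∃ G : MvPolynomial (Fin 2) R, G ≠ 0 ∧ ∀ (A : Type*) [CommRing A] [Algebra R A] (x y : A),
      MvPolynomial.aeval ![x, y] G = g.eval₂ ((Polynomial.aeval x : R[X] →ₐ[R] A) : R[X] →+* A) y := by
  refine ⟨g.eval₂ ((Polynomial.aeval (MvPolynomial.X 0) : R[X] →ₐ[R] MvPolynomial (Fin 2) R) :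
    R[X] →+* MvPolynomial (Fin 2) R) (MvPolynomial.X 1), fun h0 => hg ?_, fun A _ _ x y => ?_⟩
  · have h1 := congr_arg (MvPolynomial.aeval ![Polynomial.C Polynomial.X, Polynomial.X] :
      MvPolynomial (Fin 2) R →ₐ[R] R[X][X]) h0
    rw [← AlgHom.coe_toRingHom, Polynomial.hom_eval₂, map_zero] at h1
    refine Eq.trans ?_ h1
    refine (Polynomial.eval₂_C_X (p := g)).symm.trans ?_
    congr 1
    · ext <;> simp
    · simp
  · rw [← AlgHom.coe_toRingHom, Polynomial.hom_eval₂]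
    congr 1
    · ext <;> simp
    · simp

theorem stmt_12 (n m : ℕ) (hn : 1 ≤ n) (hm : 1 ≤ m)
    (F : Fin m → MvPolynomial (Fin (n + 1)) ℚ)
    (φ : ℝ → (Fin n → ℝ))
    (hmem : ∀ p ∈ Set.Ioo (0:ℝ) 1, ∀ j, φ p j ∈ Set.Icc (0:ℝ) 1)
    (hsol : ∀ p ∈ Set.Ioo (0:ℝ) 1, ∀ i,
      MvPolynomial.aeval (Fin.cons p (φ p)) (F i) = 0)
    (huniq : ∀ p ∈ Set.Ioo (0:ℝ) 1, ∀ x : Fin n → ℝ,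
      (∀ j, x j ∈ Set.Icc (0:ℝ) 1) →
      (∀ i, MvPolynomial.aeval (Fin.cons p x) (F i) = 0) → x = φ p) :
    ∀ j : Fin n, ∃ g : MvPolynomial (Fin 2) ℚ, g ≠ 0 ∧
      ∀ p ∈ Set.Ioo (0:ℝ) 1, MvPolynomial.aeval ![p, φ p j] g = 0 := by
  intro j
  let x (i : Fin n) : MvPolynomial (Fin n × Fin 3) (Polynomial ℚ) := MvPolynomial.X (i, 0)
  let s (i : Fin n) : MvPolynomial (Fin n × Fin 3) (Polynomial ℚ) := MvPolynomial.X (i, 1)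
  let t (i : Fin n) : MvPolynomial (Fin n × Fin 3) (Polynomial ℚ) := MvPolynomial.X (i, 2)
  let F' (i : Fin m) : MvPolynomial (Fin n × Fin 3) (Polynomial ℚ) :=
    MvPolynomial.aeval (Fin.cons (MvPolynomial.C Polynomial.X) x) (F i)
  let Q : MvPolynomial (Fin n × Fin 3) (Polynomial ℚ) :=
    ∑ i, F' i ^ 2 + ∑ i, (x i - s i ^ 2) ^ 2 + ∑ i, (1 - x i - t i ^ 2) ^ 2
  obtain ⟨g, hg, hgz⟩ := MvPolynomial.exists_zero_and_eval₂_eq_zero Q (j, 0)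
  obtain ⟨G, hG, hGg⟩ := Polynomial.exists_mvPolynomial_fin_two hg
  refine ⟨G, hG, fun p hp => ?_⟩
  let θ : Polynomial ℚ →+* ℝ := (Polynomial.aeval p : Polynomial ℚ →ₐ[ℚ] ℝ)
  have hF' (i : Fin m) (z : Fin n × Fin 3 → ℝ) : (F' i).eval₂ θ z =
      MvPolynomial.aeval (Fin.cons p fun l => z (l, 0)) (F i) := by
    have h1 := MvPolynomial.eval₂_comp_left (MvPolynomial.eval₂Hom θ z)
      (algebraMap ℚ (MvPolynomial (Fin n × Fin 3) (Polynomial ℚ)))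
      (Fin.cons (MvPolynomial.C Polynomial.X) x) (F i)
    refine h1.trans ?_
    rw [MvPolynomial.aeval_def]
    congr 1
    · exact RingHom.ext_rat _ _
    · funext l
      refine Fin.cases ?_ (fun l => ?_) l
      · simp [θ]
      · simp [x]
  have hQ (z : Fin n × Fin 3 → ℝ) : Q.eval₂ θ z =
      ∑ i, MvPolynomial.aeval (Fin.cons p fun l => z (l, 0)) (F i) ^ 2 +
      ∑ i, (z (i, 0) - z (i, 1) ^ 2) ^ 2 + ∑ i, (1 - z (i, 0) - z (i, 2) ^ 2) ^ 2 := by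
    simp only [← hF', ← MvPolynomial.coe_eval₂Hom]
    simp [Q, x, s, t]
  have hFs (z : Fin n × Fin 3 → ℝ) := Finset.sum_nonneg fun i (_ : i ∈ Finset.univ) =>
    sq_nonneg (MvPolynomial.aeval (Fin.cons p fun l => z (l, 0) : Fin (n + 1) → ℝ) (F i))
  have hss (z : Fin n × Fin 3 → ℝ) := Finset.sum_nonneg fun i (_ : i ∈ Finset.univ) =>
    sq_nonneg (z (i, 0) - z (i, 1) ^ 2)
  have hts (z : Fin n × Fin 3 → ℝ) := Finset.sum_nonneg fun i (_ : i ∈ Finset.univ) =>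
    sq_nonneg (1 - z (i, 0) - z (i, 2) ^ 2)
  obtain ⟨z, hz, hz0⟩ := hgz θ
    (fun z => by rw [hQ]; exact add_nonneg (add_nonneg (hFs z) (hss z)) (hts z))
    ⟨fun l => ![φ p l.1, √(φ p l.1), √(1 - φ p l.1)] l.2, by
      have h1 (i : Fin n) : 0 ≤ φ p i := (hmem p hp i).1
      have h2 (i : Fin n) : 0 ≤ 1 - φ p i := sub_nonneg.mpr (hmem p hp i).2
      simp [hQ, hsol p hp, Real.sq_sqrt, h1, h2]⟩
  rw [hQ] at hz
  have hF0 := (Finset.sum_eq_zero_iff_of_nonneg fun _ _ => sq_nonneg _).mp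
    (by linarith [hFs z, hss z, hts z] :
      ∑ i, MvPolynomial.aeval (Fin.cons p fun l => z (l, 0) : Fin (n + 1) → ℝ) (F i) ^ 2 = 0)
  have hs0 := (Finset.sum_eq_zero_iff_of_nonneg fun _ _ => sq_nonneg _).mp
    (by linarith [hFs z, hss z, hts z] : ∑ i, (z (i, 0) - z (i, 1) ^ 2) ^ 2 = 0)
  have ht0 := (Finset.sum_eq_zero_iff_of_nonneg fun _ _ => sq_nonneg _).mp
    (by linarith [hFs z, hss z, hts z] : ∑ i, (1 - z (i, 0) - z (i, 2) ^ 2) ^ 2 = 0)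
  have hzφ : (fun l => z (l, 0)) = φ p := by
    refine huniq p hp _ (fun i => ⟨?_, ?_⟩) fun i => ?_
    · linarith [sq_nonneg (z (i, 1)), pow_eq_zero_iff two_ne_zero |>.mp (hs0 i (Finset.mem_univ i))]
    · linarith [sq_nonneg (z (i, 2)), pow_eq_zero_iff two_ne_zero |>.mp (ht0 i (Finset.mem_univ i))]
    · exact pow_eq_zero_iff two_ne_zero |>.mp (hF0 i (Finset.mem_univ i))
  rw [hGg, ← hzφ]
  exact hz0
end

section
/- Let n, m ≥ 1, let F₁,…,F_m ∈ ℚ[p, x₁,…,x_n] be polynomials, and suppose φ : (0,1) → [0,1]^n is a function such that for every p ∈ (0,1), the point (p, φ₁(p),…,φ_n(p)) satisfies Fᵢ(p, φ(p)) = 0 for all i and is the unique such point: for every x ∈ ℝ^n with 0 ≤ xⱼ ≤ 1 for all j and Fᵢ(p,x) = 0 for all i, one has x = φ(p). Then for every p ∈ (0,1) that is algebraic over ℚ, each coordinate φⱼ(p) is algebraic over ℚ. -/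
open IntermediateField Polynomial

/-- Near a simple root, a real polynomial changes sign between two rational points. -/
theorem Polynomial.exists_rat_eval_mul_eval_neg {f : ℝ[X]} {θ : ℝ} (h0 : f.eval θ = 0)
    (h1 : f.derivative.eval θ ≠ 0) : ∃ a b : ℚ, f.eval (a : ℝ) * f.eval (b : ℝ) < 0 := by
  obtain ⟨g, rfl⟩ := dvd_iff_isRoot.mpr h0
  have hg : g.eval θ ≠ 0 := by simpa [derivative_mul] using h1
  have hpos : ∀ᶠ z : ℝ × ℝ in nhds (θ, θ), 0 < g.eval z.1 * g.eval z.2 :=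
    ContinuousAt.eventually_lt (by fun_prop) (by fun_prop) (mul_self_pos.mpr hg)
  obtain ⟨δ, hδ, hball⟩ := Metric.eventually_nhds_iff.mp hpos
  obtain ⟨a, ha, ha'⟩ := exists_rat_btwn (show θ - δ < θ by linarith)
  obtain ⟨b, hb, hb'⟩ := exists_rat_btwn (show θ < θ + δ by linarith)
  have hab : 0 < g.eval (a : ℝ) * g.eval (b : ℝ) := by
    refine @hball ((a : ℝ), (b : ℝ)) ?_
    rw [Prod.dist_eq, max_lt_iff, Real.dist_eq, Real.dist_eq, abs_lt, abs_lt]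
    exact ⟨⟨by linarith, by linarith⟩, by linarith, by linarith⟩
  refine ⟨a, b, ?_⟩
  have hsign : ((a : ℝ) - θ) * (b - θ) < 0 :=
    mul_neg_of_neg_of_pos (by linarith) (by linarith)
  calc _ = ((a : ℝ) - θ) * (b - θ) * (g.eval (a : ℝ) * g.eval (b : ℝ)) := by
        simp only [eval_mul, eval_sub, eval_X, eval_C]; ring
    _ < 0 := mul_neg_of_neg_of_pos hsign hab

theorem Polynomial.exists_eval_eq_zero_of_mul_neg {f : ℝ[X]} {a b : ℝ}
    (h : f.eval a * f.eval b < 0) : ∃ y, f.eval y = 0 := by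
  have hf : ContinuousOn (fun y ↦ f.eval y) (Set.uIcc a b) := by fun_prop
  have h0 : (0 : ℝ) ∈ Set.uIcc (f.eval a) (f.eval b) := by
    rw [Set.mem_uIcc]
    rcases mul_neg_iff.mp h with h | h
    · exact Or.inr ⟨h.2.le, h.1.le⟩
    · exact Or.inl ⟨h.1.le, h.2.le⟩
  obtain ⟨y, -, hy⟩ := intermediate_value_uIcc hf h0
  exact ⟨y, hy⟩

/-- Whether a real embedding of `E` extends to a finite extension `L` that has a real place is
decided near the given place by the sign of a single element of `E`. -/
theorem exists_neg_forall_exists_extension {E L : Type*} [Field E] [CharZero E] [Field L]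
    [Algebra E L] [FiniteDimensional E L] (ι : L →+* ℝ) :
    ∃ e : E, ι (algebraMap E L e) < 0 ∧
      ∀ σ : E →+* ℝ, σ e < 0 → ∃ τ : L →+* ℝ, τ.comp (algebraMap E L) = σ := by
  let pb := Field.powerBasisOfFiniteOfSeparable E L
  let P := minpoly E pb.gen
  have h_int : IsIntegral E pb.gen := pb.isIntegral_gen
  have heval (σ : E →+* ℝ) (a : ℚ) : (P.map σ).eval (a : ℝ) = σ (P.eval (a : E)) := by
    rw [← map_ratCast σ a, eval_map_apply]
  have h0 : (P.map (ι.comp (algebraMap E L))).eval (ι pb.gen) = 0 := by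
    rw [← Polynomial.map_map, eval_map_apply, eval_map_algebraMap, minpoly.aeval, map_zero]
  have h1 : (P.map (ι.comp (algebraMap E L))).derivative.eval (ι pb.gen) ≠ 0 := by
    rw [derivative_map, ← Polynomial.map_map, eval_map_apply, eval_map_algebraMap]
    exact (map_ne_zero ι).mpr
      ((minpoly.irreducible h_int).separable.aeval_derivative_ne_zero (minpoly.aeval _ _))
  obtain ⟨a, b, hab⟩ := exists_rat_eval_mul_eval_neg h0 h1
  refine ⟨P.eval (a : E) * P.eval (b : E), ?_, fun σ hσ ↦ ?_⟩
  · rw [heval, heval, ← map_mul] at hab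
    exact hab
  · rw [map_mul, ← heval, ← heval] at hσ
    obtain ⟨y, hy⟩ := exists_eval_eq_zero_of_mul_neg hσ
    let := σ.toAlgebra
    have hy' : aeval y P = 0 := by rwa [eval_map] at hy
    exact ⟨pb.lift y hy', (pb.lift y hy').comp_algebraMap⟩

/-- A transcendental real can be moved by a rational translation while keeping an element of the
field it generates negative. -/
theorem exists_algHom_adjoin_simple_neg {F : Type*} [Field F] [Algebra F ℝ] {t : ℝ}
    (ht : Transcendental F t) (e : F⟮t⟯) (he : (e : ℝ) < 0) :
    ∃ σ : F⟮t⟯ →ₐ[F] ℝ, σ e < 0 ∧ σ (AdjoinSimple.gen F t) ≠ t := by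
  obtain ⟨r, s, hrs⟩ := (mem_adjoin_simple_iff F (e : ℝ)).mp e.2
  have hneg : aeval t r * aeval t s < 0 := by
    rw [hrs] at he
    rcases div_neg_iff.mp he with h | h
    · exact mul_neg_of_pos_of_neg h.1 h.2
    · exact mul_neg_of_neg_of_pos h.1 h.2
  have hev : ∀ᶠ y in nhds t, aeval y r * aeval y s < 0 :=
    ContinuousAt.eventually_lt (by fun_prop) (by fun_prop) hneg
  obtain ⟨δ, hδ, hball⟩ := Metric.eventually_nhds_iff.mp hev
  obtain ⟨q, hq, hqδ⟩ := exists_rat_btwn hδ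
  have ht' : Transcendental F (t + q) := fun h ↦ ht <| by
    have hq : IsAlgebraic F (q : ℝ) := by
      rw [← map_ratCast (algebraMap F ℝ) q]
      exact isAlgebraic_algebraMap _
    simpa using h.sub hq
  have hneg' : aeval (t + (q : ℝ)) r * aeval (t + (q : ℝ)) s < 0 := by
    apply hball
    rwa [dist_self_add_left, Real.norm_of_nonneg hq.le]
  let σ : F⟮t⟯ →ₐ[F] ℝ := (val F⟮t + (q : ℝ)⟯).comp
    (((RatFunc.algEquivOfTranscendental t ht).symm.trans
      (RatFunc.algEquivOfTranscendental _ ht') : F⟮t⟯ ≃ₐ[F] F⟮t + (q : ℝ)⟯) :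
        F⟮t⟯ →ₐ[F] F⟮t + (q : ℝ)⟯)
  have hgen : σ (AdjoinSimple.gen F t) = t + q := by simp [σ]
  have hσe : σ e = aeval (t + (q : ℝ)) r / aeval (t + (q : ℝ)) s := by
    have : e = aeval (AdjoinSimple.gen F t) r / aeval (AdjoinSimple.gen F t) s := by
      apply Subtype.ext
      simpa [← aeval_algebraMap_apply] using hrs
    rw [this, map_div₀, ← aeval_algHom_apply, ← aeval_algHom_apply, hgen]
  refine ⟨σ, ?_, ?_⟩
  · rw [hσe]
    rcases mul_neg_iff.mp hneg' with h | h
    · exact div_neg_of_pos_of_neg h.1 h.2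
    · exact div_neg_of_neg_of_pos h.1 h.2
  · rw [hgen]
    simpa using hq.ne'

theorem Transcendental.exists_isAlgebraic_adjoin_simple {K A : Type*} [Field K] [Field A]
    [Algebra K A] {t : A} (ht : Transcendental K t) :
    ∃ F : IntermediateField K A, Transcendental F t ∧ Algebra.IsAlgebraic F⟮t⟯ A := by
  obtain ⟨B, htB, hB⟩ := exists_isTranscendenceBasis_superset (R := K) (s := {t})
    ((algebraicIndependent_singleton_iff (ι := ({t} : Set A)) ⟨t, rfl⟩).mpr ht)
  rw [Set.singleton_subset_iff] at htB
  refine ⟨adjoin K (B \ {t}), ?_, ?_⟩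
  · rw [transcendental_adjoin_iff]
    have h := hB.1.transcendental_adjoin (s := {x | (x : A) ≠ t}) (i := ⟨t, htB⟩) (by simp)
    have himage : Subtype.val '' {x : B | (x : A) ≠ t} = B \ {t} := by ext; simp [and_comm]
    rwa [himage] at h
  · have halg := hB.isAlgebraic_field
    have hres : (adjoin (adjoin K (B \ {t})) {t}).restrictScalars K = adjoin K B := by
      rw [adjoin_adjoin_left, Set.sdiff_union_self, Set.union_eq_left.mpr (by simpa using htB)]
    rw [Subtype.range_coe, ← hres] at halg
    exact halg

/-- A real number transcendental over `K` is moved by some real embedding over `K` of a field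
containing it together with any prescribed finite set of reals. -/
theorem Transcendental.exists_ringHom_ne {K : Type*} [Field K] [Algebra K ℝ] {t : ℝ}
    (ht : Transcendental K t) {S : Set ℝ} (hS : S.Finite) :
    ∃ (L : IntermediateField K ℝ) (τ : L →ₐ[K] ℝ), S ⊆ L ∧ ∃ u : L, (u : ℝ) = t ∧ τ u ≠ t := by
  obtain ⟨F, htF, halg⟩ := ht.exists_isAlgebraic_adjoin_simple
  have := hS.to_subtype
  let M := adjoin F⟮t⟯ S
  have : FiniteDimensional F⟮t⟯ M :=
    finiteDimensional_adjoin fun x _ ↦ Algebra.IsIntegral.isIntegral x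
  obtain ⟨e, he, hext⟩ := exists_neg_forall_exists_extension (E := F⟮t⟯) M.val.toRingHom
  obtain ⟨σ, hσ, hσt⟩ := exists_algHom_adjoin_simple_neg htF e he
  obtain ⟨τ, hτ⟩ := hext σ hσ
  have hτ' (x : F⟮t⟯) : τ (algebraMap F⟮t⟯ M x) = σ x := RingHom.congr_fun hτ x
  let L : IntermediateField K ℝ := (M.restrictScalars F).restrictScalars K
  refine ⟨L, { (τ : L →+* ℝ) with commutes' := fun k ↦ ?_ }, subset_adjoin _ S,
    algebraMap F⟮t⟯ M (AdjoinSimple.gen F t), rfl, ?_⟩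
  · have h := hτ' (algebraMap F F⟮t⟯ (algebraMap K F k))
    rw [AlgHom.commutes] at h
    exact h
  · exact (hτ' _).trans_ne hσt

theorem stmt_13 (n m : ℕ) (hn : 1 ≤ n) (hm : 1 ≤ m)
    (F : Fin m → MvPolynomial (Fin (n + 1)) ℚ)
    (φ : ℝ → (Fin n → ℝ))
    (hmem : ∀ p ∈ Set.Ioo (0:ℝ) 1, ∀ j, φ p j ∈ Set.Icc (0:ℝ) 1)
    (hsol : ∀ p ∈ Set.Ioo (0:ℝ) 1, ∀ i,
      MvPolynomial.aeval (Fin.cons p (φ p)) (F i) = 0)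
    (huniq : ∀ p ∈ Set.Ioo (0:ℝ) 1, ∀ x : Fin n → ℝ,
      (∀ j, x j ∈ Set.Icc (0:ℝ) 1) →
      (∀ i, MvPolynomial.aeval (Fin.cons p x) (F i) = 0) → x = φ p) :
    ∀ p ∈ Set.Ioo (0:ℝ) 1, IsAlgebraic ℚ p → ∀ j : Fin n, IsAlgebraic ℚ (φ p j) := by
  intro p hp hpalg j
  by_contra hj
  have hp_int : IsIntegral ℚ p := hpalg.isIntegral
  have : Algebra.IsAlgebraic ℚ ℚ⟮p⟯ := isAlgebraic_adjoin_simple hp_int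
  have ht : Transcendental ℚ⟮p⟯ (φ p j) := fun h ↦ hj (h.restrictScalars ℚ)
  obtain ⟨L, τ, hSL, u, hu, hτu⟩ := ht.exists_ringHom_ne
    (S := Set.range (φ p) ∪ Set.range (fun i ↦ √(φ p i)) ∪ Set.range (fun i ↦ √(1 - φ p i)))
    (((Set.finite_range _).union (Set.finite_range _)).union (Set.finite_range _))
  let x (i : Fin n) : L := ⟨φ p i, hSL (Or.inl (Or.inl ⟨i, rfl⟩))⟩
  let y (i : Fin n) : L := ⟨√(φ p i), hSL (Or.inl (Or.inr ⟨i, rfl⟩))⟩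
  let z (i : Fin n) : L := ⟨√(1 - φ p i), hSL (Or.inr ⟨i, rfl⟩)⟩
  let P : ℚ⟮p⟯ := AdjoinSimple.gen ℚ p
  have hy (i : Fin n) : x i = y i * y i :=
    Subtype.ext (Real.mul_self_sqrt (hmem p hp i).1).symm
  have hz (i : Fin n) : 1 - x i = z i * z i :=
    Subtype.ext (Real.mul_self_sqrt (sub_nonneg.mpr (hmem p hp i).2)).symm
  have hfix : (fun i ↦ τ (x i)) = φ p := by
    refine huniq p hp _ (fun i ↦ ⟨?_, ?_⟩) fun i ↦ ?_
    · rw [hy, map_mul]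
      exact mul_self_nonneg _
    · rw [← sub_nonneg, ← map_one τ, ← map_sub, hz, map_mul]
      exact mul_self_nonneg _
    · let w : Fin (n + 1) → L := Fin.cons (algebraMap ℚ⟮p⟯ L P) x
      have hval : (fun k ↦ L.val.restrictScalars ℚ (w k)) = Fin.cons p (φ p) := by
        funext k
        refine Fin.cases ?_ (fun k ↦ ?_) k <;> rfl
      have hτw : (fun k ↦ τ.restrictScalars ℚ (w k)) = Fin.cons p (fun i ↦ τ (x i)) := by
        funext k
        refine Fin.cases ?_ (fun k ↦ rfl) k
        exact τ.commutes P
      have hw : MvPolynomial.aeval w (F i) = 0 := by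
        have h := hsol p hp i
        rw [← hval, ← MvPolynomial.comp_aeval_apply] at h
        exact (map_eq_zero _).mp h
      rw [← hτw, ← MvPolynomial.comp_aeval_apply, hw, map_zero]
  have hux : u = x j := Subtype.ext hu
  exact hτu (hux ▸ congrFun hfix j)
end
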